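/- The Hausdorff dimension of E̲(μ,α) is given by the explicit piecewise formula: dim_H E̲(μ,α) = β1^*(α) for α ∈ [β1'(+∞), β1'(1)) ∪ [β1'(0), β1'(−∞)], and dim_H E̲(μ,α) = min{α, log 2/log A} for α ∈ [β1'(1), β1'(0)), where β1' denotes the derivative of β1. -/

import Mathlib

open MeasureTheory Filter Set Metric Topology

/-- `moranCyl c w n (x, ℓ)` refines the interval `[x, x + ℓ]` along the binary word `w`,
using the contraction ratio `c k` at step `k` (the first letter of `w` is processed with
index `n`).  The result `(x', ℓ')` describes the interval `[x', x' + ℓ']`. -/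
noncomputable def moranCyl (c : ℕ → ℝ) : List Bool → ℕ → ℝ × ℝ → ℝ × ℝ
  | [], _, st => st
  | bb :: w, n, st =>
      moranCyl c w (n + 1)
        (if bb then (st.1 + st.2 - st.2 / c n, st.2 / c n) else (st.1, st.2 / c n))

/-- The basic interval `I_w` of the Moran construction with ratios `c`. -/
noncomputable def moranI (c : ℕ → ℝ) (w : List Bool) : Set ℝ :=
  Icc (moranCyl c w 1 (0, 1)).1 ((moranCyl c w 1 (0, 1)).1 + (moranCyl c w 1 (0, 1)).2)

/-- The length `|I_w|` of the basic interval `I_w`. -/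
noncomputable def moranLen (c : ℕ → ℝ) (w : List Bool) : ℝ :=
  (moranCyl c w 1 (0, 1)).2

/-- The Moran set `⋂ n ⋃ {I_w : |w| = n}`. -/
noncomputable def moranSet (c : ℕ → ℝ) : Set ℝ :=
  ⋂ n : ℕ, ⋃ w ∈ {w : List Bool | w.length = n}, moranI c w

/-- The mass assigned to the cylinder `I_w` by the Moran measure with weight `r k` for the
letter at step `k`: `cylMass r w 1 1 = μ(I_w)`. -/
noncomputable def cylMass (r : ℕ → ℝ) : List Bool → ℕ → ℝ → ℝ
  | [], _, m => m
  | bb :: w, n, m => cylMass r w (n + 1) (if bb then (1 - r n) * m else r n * m)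

/-- Lower local dimension `liminf_{r → 0⁺} log μ(B(x,r)) / log r`. -/
noncomputable def lowerLocalDim (μ : Measure ℝ) (x : ℝ) : ℝ :=
  liminf (fun rr : ℝ => Real.log (μ (closedBall x rr)).toReal / Real.log rr) (𝓝[>] 0)

/-- Upper local dimension `limsup_{r → 0⁺} log μ(B(x,r)) / log r`. -/
noncomputable def upperLocalDim (μ : Measure ℝ) (x : ℝ) : ℝ :=
  limsup (fun rr : ℝ => Real.log (μ (closedBall x rr)).toReal / Real.log rr) (𝓝[>] 0)

/-- `betaFn ρ C s = -log (ρ^s + (1-ρ)^s) / log C`; so `β₁ = betaFn p A`, `β₂ = betaFn q B`. -/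
noncomputable def betaFn (ρ C : ℝ) (s : ℝ) : ℝ :=
  -Real.log (ρ ^ s + (1 - ρ) ^ s) / Real.log C

/-- The Legendre transform `f^*(α) = inf_s (s α - f(s))`. -/
noncomputable def legendre (f : ℝ → ℝ) (α : ℝ) : ℝ :=
  ⨅ s : ℝ, (s * α - f s)

/-- The modification `β̃₁` of `β₁`, linear on `(0,1)`. -/
noncomputable def betaTilde1 (ρ C : ℝ) (s : ℝ) : ℝ :=
  if s ≤ 0 ∨ 1 ≤ s then betaFn ρ C s
  else (1 - s) * betaFn ρ C 0 + s * betaFn ρ C 1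

/-- `packSup μ X r s` is the supremum of `∑ᵢ μ(B(xᵢ,r))^s` over all finite families of
pairwise disjoint closed balls of radius `r` with centers in `X`. -/
noncomputable def packSup (μ : Measure ℝ) (X : Set ℝ) (rr s : ℝ) : ℝ :=
  sSup {y : ℝ | ∃ t : Finset ℝ, (↑t : Set ℝ) ⊆ X ∧
    (↑t : Set ℝ).Pairwise (fun u v => Disjoint (closedBall u rr) (closedBall v rr)) ∧
    y = ∑ u ∈ t, (μ (closedBall u rr)).toReal ^ s}

/-- The common length of the basic intervals of level `n`. -/
noncomputable def mlen (c : ℕ → ℝ) (n : ℕ) : ℝ := ∏ k ∈ Finset.range n, (c (k + 1))⁻¹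

/-- The left end point of the basic interval of level `n` coded by `ω`. -/
noncomputable def mleft (c : ℕ → ℝ) (ω : ℕ → Bool) (n : ℕ) : ℝ :=
  ∑ k ∈ Finset.range n, if ω k then mlen c k - mlen c (k + 1) else 0

/-- The basic interval of level `n` coded by `ω`. -/
noncomputable def mint (c : ℕ → ℝ) (ω : ℕ → Bool) (n : ℕ) : Set ℝ :=
  Icc (mleft c ω n) (mleft c ω n + mlen c n)

/-- The weight of the letter `b` at position `k`. -/
noncomputable def bwt (v : ℕ → ℝ) (k : ℕ) (b : Bool) : ℝ := if b then 1 - v k else v k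

/-- The mass of the cylinder of level `n` around `ω` for the Bernoulli weights `v`. -/
noncomputable def bmass (v : ℕ → ℝ) (ω : ℕ → Bool) (n : ℕ) : ℝ :=
  ∏ k ∈ Finset.range n, bwt v k (ω k)

/-- The initial part of length `n` of a sequence, as a word. -/
def pref (ω : ℕ → Bool) (n : ℕ) : List Bool := (List.range n).map ω

/-- The point of the Moran set coded by `ω`. -/
noncomputable def proj (c : ℕ → ℝ) (ω : ℕ → Bool) : ℝ := ⨆ n, mleft c ω n

theorem length_pref (ω : ℕ → Bool) (n : ℕ) : (pref ω n).length = n := by simp [pref]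

theorem pref_succ (ω : ℕ → Bool) (n : ℕ) : pref ω (n + 1) = pref ω n ++ [ω n] := by
  simp [pref, List.range_succ]

theorem exists_pref_eq (w : List Bool) : ∃ ω, pref ω w.length = w := by
  refine ⟨fun k => w.getD k false, ?_⟩
  apply List.ext_getElem
  · simp [pref]
  · intro i h1 h2
    simp [pref, h2]

theorem moranCyl_append (c : ℕ → ℝ) (w : List Bool) (b : Bool) (n : ℕ) (st : ℝ × ℝ) :
    moranCyl c (w ++ [b]) n st = moranCyl c [b] (n + w.length) (moranCyl c w n st) := by
  induction w generalizing n st with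
  | nil => simp [moranCyl]
  | cons a w ih =>
    simp only [List.cons_append, moranCyl, List.length_cons]
    rw [ih, show n + (w.length + 1) = n + 1 + w.length by ring]
    simp [moranCyl]

theorem cylMass_append (r : ℕ → ℝ) (w : List Bool) (b : Bool) (n : ℕ) (m : ℝ) :
    cylMass r (w ++ [b]) n m = cylMass r [b] (n + w.length) (cylMass r w n m) := by
  induction w generalizing n m with
  | nil => simp [cylMass]
  | cons a w ih =>
    simp only [List.cons_append, cylMass, List.length_cons]
    rw [ih, show n + (w.length + 1) = n + 1 + w.length by ring]
    simp [cylMass]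

theorem mlen_succ (c : ℕ → ℝ) (n : ℕ) : mlen c (n + 1) = mlen c n / c (n + 1) := by
  simp only [mlen, Finset.prod_range_succ, div_eq_mul_inv]

theorem mleft_succ (c : ℕ → ℝ) (ω : ℕ → Bool) (n : ℕ) :
    mleft c ω (n + 1) = mleft c ω n + if ω n then mlen c n - mlen c (n + 1) else 0 := by
  simp [mleft, Finset.sum_range_succ]

theorem moranCyl_pref (c : ℕ → ℝ) (ω : ℕ → Bool) (n : ℕ) :
    moranCyl c (pref ω n) 1 (0, 1) = (mleft c ω n, mlen c n) := by
  induction n with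
  | zero => simp [pref, moranCyl, mleft, mlen]
  | succ n ih =>
    rw [pref_succ, moranCyl_append, ih, length_pref, mleft_succ, add_comm 1 n]
    cases h : ω n <;> simp [moranCyl, mlen_succ] <;> ring

theorem cylMass_pref (r : ℕ → ℝ) (ω : ℕ → Bool) (n : ℕ) :
    cylMass r (pref ω n) 1 1 = bmass (fun k => r (k + 1)) ω n := by
  induction n with
  | zero => simp [pref, cylMass, bmass]
  | succ n ih =>
    rw [pref_succ, cylMass_append, ih, length_pref, add_comm 1 n]
    simp only [cylMass, bmass, Finset.prod_range_succ, bwt]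
    split_ifs <;> ring

theorem moranI_pref (c : ℕ → ℝ) (ω : ℕ → Bool) (n : ℕ) : moranI c (pref ω n) = mint c ω n := by
  simp [moranI, mint, moranCyl_pref]

theorem mem_moranSet_iff_forall (c : ℕ → ℝ) (x : ℝ) :
    x ∈ moranSet c ↔ ∀ n, ∃ ω, x ∈ mint c ω n := by
  simp only [moranSet, mem_iInter, mem_iUnion, mem_ofPred_eq, exists_prop]
  refine forall_congr' fun n => ⟨?_, ?_⟩
  · rintro ⟨w, rfl, hx⟩
    obtain ⟨ω, hω⟩ := exists_pref_eq w
    exact ⟨ω, by rwa [← moranI_pref, hω]⟩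
  · rintro ⟨ω, hx⟩
    exact ⟨pref ω n, length_pref _ _, by rwa [moranI_pref]⟩

theorem mleft_congr (c : ℕ → ℝ) {ω ω' : ℕ → Bool} {n : ℕ} (h : ∀ k < n, ω k = ω' k) :
    mleft c ω n = mleft c ω' n :=
  Finset.sum_congr rfl fun k hk => by rw [h k (Finset.mem_range.1 hk)]

theorem mint_congr (c : ℕ → ℝ) {ω ω' : ℕ → Bool} {n : ℕ} (h : ∀ k < n, ω k = ω' k) :
    mint c ω n = mint c ω' n := by
  rw [mint, mint, mleft_congr c h]

section Geometry

variable {c : ℕ → ℝ} {B : ℝ}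

theorem mlen_pos (hB : 2 < B) (hc : ∀ k, B ≤ c (k + 1)) (n : ℕ) : 0 < mlen c n :=
  Finset.prod_pos fun k _ => inv_pos.2 (by linarith [hc k])

theorem mlen_succ_le (hB : 2 < B) (hc : ∀ k, B ≤ c (k + 1)) (n : ℕ) :
    mlen c (n + 1) ≤ mlen c n / B := by
  rw [mlen_succ]
  exact div_le_div_of_nonneg_left (mlen_pos hB hc n).le (by linarith) (hc n)

theorem mlen_succ_le_half (hB : 2 < B) (hc : ∀ k, B ≤ c (k + 1)) (n : ℕ) :
    mlen c (n + 1) ≤ mlen c n / 2 :=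
  (mlen_succ_le hB hc n).trans
    (div_le_div_of_nonneg_left (mlen_pos hB hc n).le (by norm_num) hB.le)

theorem mlen_antitone (hB : 2 < B) (hc : ∀ k, B ≤ c (k + 1)) : Antitone (mlen c) :=
  antitone_nat_of_succ_le fun n => by
    linarith [mlen_succ_le_half hB hc n, mlen_pos hB hc n]

theorem mlen_le_pow (hB : 2 < B) (hc : ∀ k, B ≤ c (k + 1)) (n : ℕ) :
    mlen c n ≤ (1 / 2) ^ n := by
  induction n with
  | zero => simp [mlen]
  | succ n ih => rw [pow_succ]; linarith [mlen_succ_le_half hB hc n]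

theorem tendsto_mlen (hB : 2 < B) (hc : ∀ k, B ≤ c (k + 1)) :
    Tendsto (mlen c) atTop (𝓝 0) :=
  squeeze_zero (fun n => (mlen_pos hB hc n).le) (mlen_le_pow hB hc)
    (tendsto_pow_atTop_nhds_zero_of_lt_one (by norm_num) (by norm_num))

theorem mint_succ_subset (hB : 2 < B) (hc : ∀ k, B ≤ c (k + 1)) (ω : ℕ → Bool) (n : ℕ) :
    mint c ω (n + 1) ⊆ mint c ω n := by
  have h1 := mlen_succ_le_half hB hc n
  have h2 := mlen_pos hB hc n
  apply Icc_subset_Icc <;> rw [mleft_succ] <;> split_ifs <;> linarith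

theorem mint_anti (hB : 2 < B) (hc : ∀ k, B ≤ c (k + 1)) (ω : ℕ → Bool) :
    Antitone (mint c ω) :=
  antitone_nat_of_succ_le fun n => mint_succ_subset hB hc ω n

theorem mint_separated (hB : 2 < B) (hc : ∀ k, B ≤ c (k + 1)) {ω ω' : ℕ → Bool} {k : ℕ}
    {x y : ℝ} (hx : x ∈ mint c ω (k + 1)) (hy : y ∈ mint c ω' (k + 1))
    (h : ∀ j < k, ω j = ω' j) (hk : ω k ≠ ω' k) : (1 - 2 / B) * mlen c k ≤ |x - y| := by
  have h1 := mlen_succ_le hB hc k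
  have h2 : (1 - 2 / B) * mlen c k ≤ mlen c k - 2 * mlen c (k + 1) := by
    have : (1 - 2 / B) * mlen c k = mlen c k - 2 * (mlen c k / B) := by ring
    linarith
  simp only [mint, mleft_succ, mem_Icc, mleft_congr c h] at hx hy
  cases h3 : ω k <;> cases h4 : ω' k <;> simp [h3, h4] at hx hy hk
  · rw [abs_sub_comm]
    exact h2.trans (le_trans (by linarith) (le_abs_self _))
  · exact h2.trans (le_trans (by linarith) (le_abs_self _))

theorem sep_pos (hB : 2 < B) : 0 < 1 - 2 / B := by
  rw [sub_pos, div_lt_one (by linarith)]; exact hB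

theorem sep_lt_one (hB : 2 < B) : 1 - 2 / B < 1 := by
  have : 0 < 2 / B := by positivity
  linarith

theorem eq_of_close (hB : 2 < B) (hc : ∀ k, B ≤ c (k + 1)) {ω ω' : ℕ → Bool} {n : ℕ}
    {x y : ℝ} (hx : x ∈ mint c ω (n + 1)) (hy : y ∈ mint c ω' (n + 1))
    (h : |x - y| < (1 - 2 / B) * mlen c n) : ∀ k < n + 1, ω k = ω' k := by
  intro k
  induction k using Nat.strong_induction_on with
  | _ k ih =>
    intro hk
    by_contra hne
    have h1 := mint_separated hB hc (mint_anti hB hc ω (show k + 1 ≤ n + 1 by omega) hx)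
      (mint_anti hB hc ω' (show k + 1 ≤ n + 1 by omega) hy)
      (fun j hj => ih j hj (by omega)) hne
    have h2 := mul_le_mul_of_nonneg_left (mlen_antitone hB hc (show k ≤ n by omega))
      (sep_pos hB).le
    linarith

theorem mem_moranSet_iff (hB : 2 < B) (hc : ∀ k, B ≤ c (k + 1)) (x : ℝ) :
    x ∈ moranSet c ↔ ∃ ω, ∀ n, x ∈ mint c ω n := by
  rw [mem_moranSet_iff_forall]
  refine ⟨fun h => ?_, fun ⟨ω, h⟩ n => ⟨ω, h n⟩⟩
  choose W hW using h
  refine ⟨fun k => W (k + 1) k, fun n => ?_⟩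
  have : ∀ k < n, W (k + 1) k = W n k := by
    intro k hk
    refine eq_of_close hB hc (hW (k + 1)) (mint_anti hB hc _ (show k + 1 ≤ n by omega) (hW n)) ?_
      k (by omega)
    simpa using mul_pos (sep_pos hB) (mlen_pos hB hc k)
  rw [mint_congr c this]
  exact hW n

theorem mleft_le_add (hB : 2 < B) (hc : ∀ k, B ≤ c (k + 1)) (ω : ℕ → Bool) (m n : ℕ) :
    mleft c ω m ≤ mleft c ω n + mlen c n := by
  have key : ∀ k, mleft c ω k ∈ mint c ω k := fun k => by
    simp [mint, (mlen_pos hB hc k).le]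
  rcases le_total m n with h | h
  · have := (mint_anti hB hc ω h (key n)).1
    linarith [mlen_pos hB hc n]
  · exact (mint_anti hB hc ω h (key m)).2

theorem proj_mem (hB : 2 < B) (hc : ∀ k, B ≤ c (k + 1)) (ω : ℕ → Bool) (n : ℕ) :
    proj c ω ∈ mint c ω n :=
  ⟨le_ciSup ⟨mleft c ω 0 + mlen c 0, by rintro _ ⟨m, rfl⟩; exact mleft_le_add hB hc ω m 0⟩ n,
    ciSup_le fun m => mleft_le_add hB hc ω m n⟩

theorem proj_mem_moranSet (hB : 2 < B) (hc : ∀ k, B ≤ c (k + 1)) (ω : ℕ → Bool) :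
    proj c ω ∈ moranSet c :=
  (mem_moranSet_iff hB hc _).2 ⟨ω, proj_mem hB hc ω⟩

theorem measurable_proj (c : ℕ → ℝ) : Measurable (proj c) := by
  refine Measurable.iSup fun n => ?_
  refine Finset.measurable_sum _ fun k _ => ?_
  exact (measurable_of_countable
    (fun b : Bool => if b then mlen c k - mlen c (k + 1) else 0)).comp (measurable_pi_apply k)

theorem exists_scale (hB : 2 < B) (hc : ∀ k, B ≤ c (k + 1)) {ρ : ℝ} (hρ : 0 < ρ)
    (m : ℕ) (hρm : ρ < (1 - 2 / B) * mlen c m) :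
    ∃ n, m ≤ n ∧ (1 - 2 / B) * mlen c (n + 1) ≤ ρ ∧ ρ < (1 - 2 / B) * mlen c n := by
  have h0 : Tendsto (fun n => (1 - 2 / B) * mlen c n) atTop (𝓝 0) := by
    simpa using (tendsto_mlen hB hc).const_mul (1 - 2 / B)
  have hex : ∃ n, (1 - 2 / B) * mlen c n ≤ ρ := ((h0.eventually_lt_const hρ).mono
    fun n hn => hn.le).exists
  classical
  have hspec := Nat.find_spec hex
  have hmin := fun {k} => Nat.find_min hex (m := k)
  have hlt : m < Nat.find hex := by
    by_contra hle
    have h2 := mul_le_mul_of_nonneg_left (mlen_antitone hB hc (not_lt.1 hle)) (sep_pos hB).le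
    linarith
  obtain ⟨k, hk⟩ : ∃ k, Nat.find hex = k + 1 := ⟨Nat.find hex - 1, by omega⟩
  refine ⟨k, by omega, hk ▸ hspec, not_le.1 (hmin (by omega))⟩

end Geometry

/-- Extension of a finite word to a sequence. -/
def extw {n : ℕ} (x : Fin n → Bool) (k : ℕ) : Bool := if h : k < n then x ⟨k, h⟩ else false

theorem extw_apply {n : ℕ} (x : Fin n → Bool) (i : Fin n) : extw x i = x i := by simp [extw]

theorem extw_restrict (ω : ℕ → Bool) (n : ℕ) :
    ∀ k < n, extw (fun i : Fin n => ω i) k = ω k := fun k hk => by simp [extw, hk]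

theorem sum_bmass (v : ℕ → ℝ) (n : ℕ) : ∑ x : Fin n → Bool, bmass v (extw x) n = 1 := by
  have h : ∀ x : Fin n → Bool, bmass v (extw x) n = ∏ i : Fin n, bwt v i (x i) := fun x => by
    simp only [bmass, Finset.prod_range, extw_apply]
  simp_rw [h]
  rw [← Fintype.prod_sum (fun (i : Fin n) b => bwt v i b)]
  simp [bwt]

theorem bwt_nonneg {v : ℕ → ℝ} (hv0 : ∀ k, 0 < v k) (hv1 : ∀ k, v k < 1) (k : ℕ) (b : Bool) :
    0 < bwt v k b := by
  have := hv0 k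
  have := hv1 k
  unfold bwt
  split_ifs <;> linarith

/-- Sum of the logarithms of the inverse contraction ratios. -/
noncomputable def logLen (c : ℕ → ℝ) (n : ℕ) : ℝ := ∑ k ∈ Finset.range n, Real.log (c (k + 1))

/-- Minus the logarithm of the mass of the cylinder of level `n` around `ω`. -/
noncomputable def logMass (v : ℕ → ℝ) (ω : ℕ → Bool) (n : ℕ) : ℝ :=
  ∑ k ∈ Finset.range n, -Real.log (bwt v k (ω k))

theorem bmass_eq_exp {v : ℕ → ℝ} (hv0 : ∀ k, 0 < v k) (hv1 : ∀ k, v k < 1) (ω : ℕ → Bool)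
    (n : ℕ) : bmass v ω n = Real.exp (-logMass v ω n) := by
  rw [logMass, Finset.sum_neg_distrib, neg_neg, Real.exp_sum]
  exact Finset.prod_congr rfl fun k _ => (Real.exp_log (bwt_nonneg hv0 hv1 _ _)).symm

section Balls

variable {c : ℕ → ℝ} {B : ℝ}

theorem mlen_eq_exp (hB : 2 < B) (hc : ∀ k, B ≤ c (k + 1)) (n : ℕ) :
    mlen c n = Real.exp (-logLen c n) := by
  rw [logLen, ← Finset.sum_neg_distrib, Real.exp_sum]
  refine Finset.prod_congr rfl fun k _ => ?_
  rw [Real.exp_neg, Real.exp_log (by linarith [hc k])]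

theorem log_mlen (hB : 2 < B) (hc : ∀ k, B ≤ c (k + 1)) (n : ℕ) :
    Real.log (mlen c n) = -logLen c n := by
  rw [mlen_eq_exp hB hc, Real.log_exp]

theorem mul_le_logLen (hB : 2 < B) (hc : ∀ k, B ≤ c (k + 1)) (n : ℕ) :
    n * Real.log B ≤ logLen c n := by
  have : ∑ k ∈ Finset.range n, Real.log B ≤ logLen c n :=
    Finset.sum_le_sum fun k _ => Real.log_le_log (by linarith) (hc k)
  simpa using this

theorem log_ratio_pos (hB : 2 < B) : 0 < Real.log B := Real.log_pos (by linarith)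

theorem tendsto_logLen (hB : 2 < B) (hc : ∀ k, B ≤ c (k + 1)) :
    Tendsto (logLen c) atTop atTop :=
  tendsto_atTop_mono (mul_le_logLen hB hc)
    (tendsto_natCast_atTop_atTop.atTop_mul_const (log_ratio_pos hB))

theorem logLen_mono (hB : 2 < B) (hc : ∀ k, B ≤ c (k + 1)) : Monotone (logLen c) :=
  monotone_nat_of_le_succ fun n => by
    rw [logLen, logLen, Finset.sum_range_succ]
    linarith [Real.log_pos (show 1 < c (n + 1) by linarith [hc n])]

theorem measurableSet_mint (c : ℕ → ℝ) (ω : ℕ → Bool) (n : ℕ) : MeasurableSet (mint c ω n) :=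
  measurableSet_Icc

theorem eq_of_mem_mint (hB : 2 < B) (hc : ∀ k, B ≤ c (k + 1)) {ω ω' : ℕ → Bool} {n : ℕ} {x : ℝ}
    (hx : x ∈ mint c ω n) (hy : x ∈ mint c ω' n) : ∀ k < n, ω k = ω' k := by
  cases n with
  | zero => intro k hk; omega
  | succ n =>
    exact eq_of_close hB hc hx hy (by simpa using mul_pos (sep_pos hB) (mlen_pos hB hc n))

variable {μ : Measure ℝ} [IsProbabilityMeasure μ] {v : ℕ → ℝ}

theorem measure_compl_iUnion_mint (hB : 2 < B) (hc : ∀ k, B ≤ c (k + 1))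
    (hv0 : ∀ k, 0 < v k) (hv1 : ∀ k, v k < 1)
    (hμ : ∀ ω n, μ (mint c ω n) = ENNReal.ofReal (bmass v ω n)) (n : ℕ) :
    μ (⋃ x : Fin n → Bool, mint c (extw x) n)ᶜ = 0 := by
  rw [prob_compl_eq_zero_iff (MeasurableSet.iUnion fun x => measurableSet_mint _ _ _),
    measure_iUnion _ fun x => measurableSet_mint _ _ _]
  · rw [tsum_fintype]
    simp_rw [hμ]
    rw [← ENNReal.ofReal_sum_of_nonneg, sum_bmass, ENNReal.ofReal_one]
    exact fun x _ => (bmass_eq_exp hv0 hv1 _ _).symm ▸ (Real.exp_pos _).le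
  · intro x y hxy
    refine Set.disjoint_left.2 fun z hz hz' => hxy (funext fun i => ?_)
    simpa [extw_apply] using eq_of_mem_mint hB hc hz hz' i i.2

theorem measure_closedBall_le (hB : 2 < B) (hc : ∀ k, B ≤ c (k + 1))
    (hv0 : ∀ k, 0 < v k) (hv1 : ∀ k, v k < 1)
    (hμ : ∀ ω n, μ (mint c ω n) = ENNReal.ofReal (bmass v ω n)) {ω : ℕ → Bool} {n : ℕ} {x ρ : ℝ}
    (hx : x ∈ mint c ω (n + 1)) (hρ : ρ < (1 - 2 / B) * mlen c n) :
    (μ (closedBall x ρ)).toReal ≤ Real.exp (-logMass v ω (n + 1)) := by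
  refine ENNReal.toReal_le_of_le_ofReal (Real.exp_pos _).le ?_
  rw [← bmass_eq_exp hv0 hv1, ← hμ]
  calc μ (closedBall x ρ)
      ≤ μ (mint c ω (n + 1) ∪ (⋃ x : Fin (n + 1) → Bool, mint c (extw x) (n + 1))ᶜ) := by
        refine measure_mono fun y hy => ?_
        by_cases h : y ∈ ⋃ x : Fin (n + 1) → Bool, mint c (extw x) (n + 1)
        · left
          obtain ⟨z, hz⟩ := mem_iUnion.1 h
          rw [mint_congr c (eq_of_close hB hc hx hz _)]
          · exact hz
          · rw [abs_sub_comm]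
            exact lt_of_le_of_lt (by simpa [Real.dist_eq] using hy) hρ
        · exact Or.inr h
    _ ≤ μ (mint c ω (n + 1)) + 0 := by
        rw [← measure_compl_iUnion_mint hB hc hv0 hv1 hμ (n + 1)]
        exact measure_union_le _ _
    _ = _ := add_zero _

theorem le_measure_closedBall
    (hv0 : ∀ k, 0 < v k) (hv1 : ∀ k, v k < 1)
    (hμ : ∀ ω n, μ (mint c ω n) = ENNReal.ofReal (bmass v ω n)) {ω : ℕ → Bool} {n : ℕ} {x ρ : ℝ}
    (hx : x ∈ mint c ω n) (hρ : mlen c n ≤ ρ) :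
    Real.exp (-logMass v ω n) ≤ (μ (closedBall x ρ)).toReal := by
  rw [← ENNReal.ofReal_le_iff_le_toReal (measure_ne_top _ _), ← bmass_eq_exp hv0 hv1, ← hμ]
  refine measure_mono fun y hy => ?_
  simp only [mint, mem_Icc] at hx hy
  rw [mem_closedBall, Real.dist_eq, abs_le]
  constructor <;> linarith

theorem lowerLocalDim_eq_iff (hB : 2 < B) (hc : ∀ k, B ≤ c (k + 1))
    (hv0 : ∀ k, 0 < v k) (hv1 : ∀ k, v k < 1)
    (hμ : ∀ ω n, μ (mint c ω n) = ENNReal.ofReal (bmass v ω n)) {K : ℝ}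
    {ω : ℕ → Bool} (hK : ∀ n, logMass v ω n ≤ K * logLen c n) {x : ℝ}
    (hx : ∀ n, x ∈ mint c ω n) {α : ℝ} (hα : 0 < α) :
    lowerLocalDim μ x = α ↔
      (∀ ε > 0, ∀ᶠ n in atTop, (α - ε) * logLen c n ≤ logMass v ω n) ∧
      (∀ ε > 0, ∃ᶠ n in atTop, logMass v ω n ≤ (α + ε) * logLen c n) := by
  set f : ℝ → ℝ := fun ρ => Real.log (μ (closedBall x ρ)).toReal / Real.log ρ with hf
  have hdim : lowerLocalDim μ x = liminf f (𝓝[>] 0) := rfl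
  set δ := 1 - 2 / B with hδ
  have hδ0 : 0 < δ := sep_pos hB
  have hδ1 : δ < 1 := sep_lt_one hB
  have hlδ : Real.log δ < 0 := Real.log_neg hδ0 hδ1
  have hlen : Tendsto (mlen c) atTop (𝓝[>] 0) :=
    tendsto_nhdsWithin_iff.2 ⟨tendsto_mlen hB hc, Eventually.of_forall fun n => mlen_pos hB hc n⟩
  have hlarge : ∀ C : ℝ, ∀ᶠ n in atTop, C < logLen c n := fun C =>
    (tendsto_logLen hB hc).eventually_gt_atTop C
  have hnonneg : ∀ ρ, 0 < ρ → ρ < 1 → 0 ≤ f ρ := fun ρ h0 h1 =>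
    div_nonneg_of_nonpos (Real.log_nonpos ENNReal.toReal_nonneg
      (ENNReal.toReal_le_of_le_ofReal zero_le_one (by simpa using prob_le_one)))
      (Real.log_nonpos h0.le h1.le)
  have hupp : ∀ n, 0 < logLen c n → f (mlen c n) * logLen c n ≤ logMass v ω n := by
    intro n hn
    have h1 := le_measure_closedBall (μ := μ) hv0 hv1 hμ (hx n) le_rfl
    have h2 := Real.log_le_log (Real.exp_pos _) h1
    rw [Real.log_exp] at h2
    have h3 : f (mlen c n) * logLen c n = -Real.log (μ (closedBall x (mlen c n))).toReal := by
      simp only [hf]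
      rw [log_mlen hB hc]
      field_simp
    linarith
  have hlow : ∀ m ρ, 0 < ρ → ρ < 1 → ρ < δ * mlen c m → ∃ n, m ≤ n ∧
      logMass v ω (n + 1) ≤ f ρ * (-Real.log ρ) ∧
      -Real.log ρ ≤ logLen c (n + 1) - Real.log δ := by
    intro m ρ h0 h01 h1
    obtain ⟨n, hmn, h2, h3⟩ := exists_scale hB hc h0 m h1
    refine ⟨n, hmn, ?_, ?_⟩
    · have h4 := measure_closedBall_le (μ := μ) hB hc hv0 hv1 hμ (hx (n + 1)) h3
      obtain ⟨j, hj⟩ := ((tendsto_mlen hB hc).eventually_lt_const h0).exists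
      have h5 : 0 < (μ (closedBall x ρ)).toReal :=
        (Real.exp_pos _).trans_le (le_measure_closedBall (μ := μ) hv0 hv1 hμ (hx j) hj.le)
      have h6 := Real.log_le_log h5 h4
      rw [Real.log_exp] at h6
      have h7 : f ρ * (-Real.log ρ) = -Real.log (μ (closedBall x ρ)).toReal := by
        have : Real.log ρ ≠ 0 := (Real.log_neg h0 h01).ne
        simp only [hf]
        field_simp
      linarith
    · have h4 := Real.log_le_log (mul_pos hδ0 (mlen_pos hB hc _)) h2
      rw [Real.log_mul hδ0.ne' (mlen_pos hB hc _).ne', log_mlen hB hc] at h4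
      linarith
  have hsmall : ∀ m, ∀ᶠ ρ in 𝓝[>] (0 : ℝ), 0 < ρ ∧ ρ < 1 ∧ ρ < δ * mlen c m := by
    intro m
    filter_upwards [self_mem_nhdsWithin, nhdsWithin_le_nhds (eventually_lt_nhds one_pos),
      nhdsWithin_le_nhds (eventually_lt_nhds (mul_pos hδ0 (mlen_pos hB hc m)))] with ρ h1 h2 h3
    exact ⟨h1, h2, h3⟩
  have hbdd : IsBoundedUnder (· ≥ ·) (𝓝[>] 0) f :=
    isBoundedUnder_of_eventually_ge (a := 0)
      ((hsmall 0).mono fun ρ h => hnonneg ρ h.1 h.2.1)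
  have hfreq : ∀ a, (∃ᶠ n in atTop, logMass v ω n ≤ a * logLen c n) →
      ∃ᶠ ρ in 𝓝[>] 0, f ρ ≤ a := by
    intro a ha
    refine hlen.frequently ((ha.and_eventually (hlarge 0)).mono fun n hn => ?_)
    have := (hupp n hn.2).trans hn.1
    exact le_of_mul_le_mul_right this hn.2
  have hcob : IsCoboundedUnder (· ≥ ·) (𝓝[>] 0) f :=
    IsCoboundedUnder.of_frequently_le (hfreq K (Eventually.frequently (Eventually.of_forall hK)))
  rw [hdim]
  constructor
  · rintro rfl
    set α := liminf f (𝓝[>] 0) with hαd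
    constructor
    · intro ε hε
      have h1 : ∀ᶠ ρ in 𝓝[>] 0, α - ε < f ρ :=
        eventually_lt_of_lt_liminf (by rw [← hαd]; linarith) hbdd
      filter_upwards [hlen.eventually h1, hlarge 0] with n hn hn0
      exact (mul_le_mul_of_nonneg_right hn.le hn0.le).trans (hupp n hn0)
    · intro ε hε
      have h1 : ∃ᶠ ρ in 𝓝[>] 0, f ρ < α + ε / 2 :=
        frequently_lt_of_liminf_lt hcob (by rw [← hαd]; linarith)
      refine frequently_atTop.2 fun m => ?_
      obtain ⟨m', hm', hm''⟩ := ((hlarge ((α + ε / 2) * (-Real.log δ) / (ε / 2))).and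
        (eventually_ge_atTop m)).exists
      rw [div_lt_iff₀ (by positivity)] at hm'
      obtain ⟨ρ, hρ, h0, h01, h2⟩ := (h1.and_eventually (hsmall m')).exists
      obtain ⟨n, hn, h3, h4⟩ := hlow m' ρ h0 h01 h2
      refine ⟨n + 1, by omega, ?_⟩
      have h5 := logLen_mono hB hc (show m' ≤ n + 1 by omega)
      have h6 : f ρ * (-Real.log ρ) ≤ (α + ε / 2) * (-Real.log ρ) :=
        mul_le_mul_of_nonneg_right hρ.le (by linarith [Real.log_neg h0 h01])
      have h7 := mul_le_mul_of_nonneg_left h4 (show 0 ≤ α + ε / 2 by linarith)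
      nlinarith
  · rintro ⟨h1, h2⟩
    refine le_antisymm ?_ ?_
    · refine le_of_forall_pos_le_add fun ε hε => ?_
      exact liminf_le_of_frequently_le (hfreq _ (h2 ε hε)) hbdd
    · refine le_of_forall_pos_le_add fun ε hε => ?_
      rw [← sub_le_iff_le_add]
      refine le_liminf_of_le hcob ?_
      obtain ⟨m, hm⟩ := eventually_atTop.1 ((h1 (ε / 2) (by positivity)).and
        (hlarge (α * (-Real.log δ) / (ε / 2))))
      filter_upwards [hsmall m] with ρ ⟨h0, h01, h3⟩
      rcases le_total (α - ε) 0 with h | h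
      · exact h.trans (hnonneg ρ h0 h01)
      obtain ⟨n, hn, h4, h5⟩ := hlow m ρ h0 h01 h3
      obtain ⟨h6, h7⟩ := hm (n + 1) (by omega)
      rw [div_lt_iff₀ (by positivity)] at h7
      have h8 : 0 < -Real.log ρ := by linarith [Real.log_neg h0 h01]
      refine le_of_mul_le_mul_right ?_ h8
      have h9 := mul_le_mul_of_nonneg_left h5 h
      nlinarith

end Balls

section Upper

variable {c : ℕ → ℝ} {B : ℝ} {v : ℕ → ℝ}

theorem ediam_mint (c : ℕ → ℝ) (ω : ℕ → Bool) (n : ℕ) :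
    ediam (mint c ω n) = ENNReal.ofReal (mlen c n) := by
  rw [mint, Real.ediam_Icc, add_sub_cancel_left]

theorem dimH_le_add_of_frequently (hB : 2 < B) (hc : ∀ k, B ≤ c (k + 1))
    (hv0 : ∀ k, 0 < v k) (hv1 : ∀ k, v k < 1) {E : Set ℝ} {d ε : ℝ} (hd : 0 ≤ d) (hε : 0 < ε)
    (h : ∀ x ∈ E, ∃ ω, (∀ n, x ∈ mint c ω n) ∧
      ∃ᶠ n in atTop, logMass v ω n ≤ d * logLen c n) :
    dimH E ≤ ENNReal.ofReal (d + ε) := by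
  have hdε : 0 < d + ε := by positivity
  classical
  let t : ∀ m : ℕ, (Σ k : ℕ, Fin (m + k) → Bool) → Set ℝ := fun m i =>
    if logMass v (extw i.2) (m + i.1) ≤ d * logLen c (m + i.1) then mint c (extw i.2) (m + i.1)
    else ∅
  have hdiam : ∀ m i, ediam (t m i) ≤ ENNReal.ofReal (mlen c m) := by
    intro m i
    simp only [t]
    split_ifs
    · rw [ediam_mint]
      exact ENNReal.ofReal_le_ofReal (mlen_antitone hB hc (by omega))
    · simp
  have hcov : ∀ m, E ⊆ ⋃ i, t m i := by
    intro m x hx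
    obtain ⟨ω, hω, hf⟩ := h x hx
    obtain ⟨n, hn, hle⟩ := frequently_atTop.1 hf m
    obtain ⟨k, rfl⟩ := Nat.exists_eq_add_of_le hn
    refine mem_iUnion.2 ⟨⟨k, fun i => ω i⟩, ?_⟩
    have h1 := extw_restrict ω (m + k)
    have h2 : logMass v (extw fun i : Fin (m + k) => ω i) (m + k) = logMass v ω (m + k) :=
      Finset.sum_congr rfl fun j hj => by rw [h1 j (Finset.mem_range.1 hj)]
    simp only [t, h2, if_pos hle, mint_congr c h1]
    exact hω _
  set θ := Real.exp (-(ε * Real.log B)) with hθ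
  have hθ0 : 0 < θ := Real.exp_pos _
  have hθ1 : θ < 1 := Real.exp_lt_one_iff.2 (by
    have := mul_pos hε (log_ratio_pos hB)
    linarith)
  have hterm : ∀ m (i : Σ k : ℕ, Fin (m + k) → Bool), ediam (t m i) ^ (d + ε) ≤
      ENNReal.ofReal (θ ^ i.1 * bmass v (extw i.2) (m + i.1)) := by
    intro m i
    simp only [t]
    split_ifs with hi
    · rw [ediam_mint, ENNReal.ofReal_rpow_of_pos (mlen_pos hB hc _)]
      refine ENNReal.ofReal_le_ofReal ?_
      rw [mlen_eq_exp hB hc, bmass_eq_exp hv0 hv1, ← Real.exp_mul, hθ, ← Real.exp_nat_mul,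
        ← Real.exp_add, Real.exp_le_exp]
      have h1 := mul_le_logLen hB hc (m + i.1)
      have h2 : (i.1 : ℝ) * Real.log B ≤ ((m + i.1 : ℕ) : ℝ) * Real.log B :=
        mul_le_mul_of_nonneg_right (by exact_mod_cast Nat.le_add_left _ _) (log_ratio_pos hB).le
      nlinarith
    · rw [ediam_empty, ENNReal.zero_rpow_of_pos hdε]
      exact zero_le
  have hsum : ∀ m, ∑' i, ediam (t m i) ^ (d + ε) ≤ (1 - ENNReal.ofReal θ)⁻¹ := by
    intro m
    refine (ENNReal.tsum_le_tsum (hterm m)).trans ?_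
    rw [ENNReal.tsum_sigma', ← ENNReal.tsum_geometric]
    refine ENNReal.tsum_le_tsum fun k => ?_
    rw [tsum_fintype, ← ENNReal.ofReal_sum_of_nonneg]
    · dsimp only
      rw [← Finset.mul_sum, sum_bmass, mul_one, ENNReal.ofReal_pow hθ0.le]
    · exact fun x _ => mul_nonneg (by positivity)
        ((bmass_eq_exp hv0 hv1 _ _).symm ▸ (Real.exp_pos _).le)
  have hle := Measure.hausdorffMeasure_le_liminf_tsum (d + ε) E (l := atTop)
    (fun m => ENNReal.ofReal (mlen c m))
    (by simpa using ENNReal.tendsto_ofReal (tendsto_mlen hB hc)) t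
    (Eventually.of_forall hdiam) (Eventually.of_forall hcov)
  have hfin : Measure.hausdorffMeasure (d + ε) E ≠ ⊤ := by
    refine ne_top_of_le_ne_top ?_ (hle.trans
      (liminf_le_of_frequently_le' (Eventually.frequently (Eventually.of_forall hsum))))
    rw [ENNReal.inv_ne_top, Ne, tsub_eq_zero_iff_le, not_le]
    exact ENNReal.ofReal_lt_one.2 hθ1
  have : ((d + ε).toNNReal : ℝ) = d + ε := Real.coe_toNNReal _ hdε.le
  exact dimH_le_of_hausdorffMeasure_ne_top (d := (d + ε).toNNReal) (by rwa [this])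

/-- If a set is coded by sequences whose cylinders have, infinitely often, mass at least their
length to the power `d`, then its dimension is at most `d`. -/
theorem dimH_le_of_frequently (hB : 2 < B) (hc : ∀ k, B ≤ c (k + 1))
    (hv0 : ∀ k, 0 < v k) (hv1 : ∀ k, v k < 1) {E : Set ℝ} {d : ℝ} (hd : 0 ≤ d)
    (h : ∀ x ∈ E, ∃ ω, (∀ n, x ∈ mint c ω n) ∧
      ∀ ε > 0, ∃ᶠ n in atTop, logMass v ω n ≤ (d + ε) * logLen c n) :
    dimH E ≤ ENNReal.ofReal d := by
  refine ENNReal.le_of_forall_pos_le_add fun ε hε _ => ?_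
  have hε' : (0 : ℝ) < ε / 2 := by positivity
  have := dimH_le_add_of_frequently hB hc hv0 hv1 (d := d + ε / 2) (ε := ε / 2)
    (by positivity) hε' (fun x hx => by
      obtain ⟨ω, hω, hf⟩ := h x hx
      exact ⟨ω, hω, hf _ hε'⟩)
  rwa [add_assoc, add_halves, ENNReal.ofReal_add hd ε.coe_nonneg, ENNReal.ofReal_coe_nnreal] at this

end Upper

section LargeNumbers

open ProbabilityTheory

variable {Ω : Type*} [MeasurableSpace Ω] {P : Measure Ω} [IsProbabilityMeasure P]

theorem ae_eventually_sum_lt {X : ℕ → Ω → ℝ} (hX : ∀ k, Measurable (X k))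
    (hind : iIndepFun X P) {K : ℝ} (hK : 0 < K) (hb : ∀ k ω, X k ω ∈ Icc (-K) K)
    (hm : ∀ k, ∫ ω, X k ω ∂P = 0) {ε : ℝ} (hε : 0 < ε) :
    ∀ᵐ ω ∂P, ∀ᶠ n : ℕ in atTop, ∑ k ∈ Finset.range n, X k ω < ε * n := by
  have hsub : ∀ k, HasSubgaussianMGF (X k) ((‖K - -K‖₊ / 2) ^ 2) P := fun k =>
    hasSubgaussianMGF_of_mem_Icc_of_integral_eq_zero (hX k).aemeasurable
      (Eventually.of_forall (hb k)) (hm k)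
  have hcoe : (((‖K - -K‖₊ / 2) ^ 2 : NNReal) : ℝ) = K ^ 2 := by
    push_cast
    rw [sub_neg_eq_add, Real.norm_of_nonneg (by linarith)]
    ring
  have hbound : ∀ n : ℕ, P {ω | ε * n ≤ ∑ k ∈ Finset.range n, X k ω} ≤
      ENNReal.ofReal (Real.exp (-(ε ^ 2 / (2 * K ^ 2))) ^ n) := by
    intro n
    have h := HasSubgaussianMGF.measure_sum_range_ge_le_of_iIndepFun hind (n := n) (fun i _ => hsub i)
      (show 0 ≤ ε * n by positivity)
    rw [hcoe] at h
    rw [← ofReal_measureReal]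
    refine ENNReal.ofReal_le_ofReal (h.trans ?_)
    rw [← Real.exp_nat_mul, Real.exp_le_exp]
    rcases Nat.eq_zero_or_pos n with rfl | hn
    · simp
    · apply le_of_eq
      field_simp
  have hlt : Real.exp (-(ε ^ 2 / (2 * K ^ 2))) < 1 :=
    Real.exp_lt_one_iff.2 (neg_lt_zero.2 (by positivity))
  have hsum : ∑' n : ℕ, P {ω | ε * n ≤ ∑ k ∈ Finset.range n, X k ω} ≠ ⊤ := by
    refine ne_top_of_le_ne_top ?_ (ENNReal.tsum_le_tsum hbound)
    rw [← ENNReal.ofReal_tsum_of_nonneg (fun n => by positivity)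
      (summable_geometric_of_lt_one (Real.exp_pos _).le hlt)]
    exact ENNReal.ofReal_ne_top
  filter_upwards [ae_eventually_notMem hsum] with ω hω
  filter_upwards [hω] with n hn
  simpa using hn

/-- A strong law of large numbers for uniformly bounded independent centered variables. -/
theorem ae_tendsto_average {X : ℕ → Ω → ℝ} (hX : ∀ k, Measurable (X k))
    (hind : iIndepFun X P) {K : ℝ} (hK : 0 < K) (hb : ∀ k ω, X k ω ∈ Icc (-K) K)
    (hm : ∀ k, ∫ ω, X k ω ∂P = 0) :
    ∀ᵐ ω ∂P, ∀ ε > 0, ∀ᶠ n : ℕ in atTop, |∑ k ∈ Finset.range n, X k ω| ≤ ε * n := by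
  have h1 : ∀ j : ℕ, ∀ᵐ ω ∂P, ∀ᶠ n : ℕ in atTop,
      ∑ k ∈ Finset.range n, X k ω < (1 / ((j : ℝ) + 1)) * n := fun j =>
    ae_eventually_sum_lt hX hind hK hb hm (by positivity)
  have h2 : ∀ j : ℕ, ∀ᵐ ω ∂P, ∀ᶠ n : ℕ in atTop,
      ∑ k ∈ Finset.range n, -X k ω < (1 / ((j : ℝ) + 1)) * n := fun j =>
    ae_eventually_sum_lt (X := fun k ω => -X k ω) (fun k => (hX k).neg)
      (hind.comp (fun _ => Neg.neg) (fun _ => measurable_neg)) hK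
      (fun k ω => ⟨by linarith [(hb k ω).2], by linarith [(hb k ω).1]⟩)
      (fun k => by rw [integral_neg, hm, neg_zero]) (by positivity)
  filter_upwards [ae_all_iff.2 h1, ae_all_iff.2 h2] with ω hω1 hω2 ε hε
  obtain ⟨j, hj⟩ := exists_nat_one_div_lt hε
  filter_upwards [hω1 j, hω2 j] with n hn1 hn2
  have h3 : (1 / ((j : ℝ) + 1)) * n ≤ ε * n := mul_le_mul_of_nonneg_right hj.le (Nat.cast_nonneg n)
  rw [Finset.sum_neg_distrib] at hn2
  rw [abs_le]
  constructor <;> linarith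

/-- Expectation of a function on letters for the weights `v`. -/
noncomputable def bmean (v : ℕ → ℝ) (k : ℕ) (f : Bool → ℝ) : ℝ :=
  v k * f false + (1 - v k) * f true

theorem exists_bernoulli_measure {v : ℕ → ℝ} (hv0 : ∀ k, 0 < v k) (hv1 : ∀ k, v k < 1) :
    ∃ P : Measure (ℕ → Bool), IsProbabilityMeasure P ∧
      (∀ ω n, P {ω' | ∀ k < n, ω' k = ω k} = ENNReal.ofReal (bmass v ω n)) ∧
      ∀ (f : ℕ → Bool → ℝ) (K : ℝ), (∀ k b, |f k b| ≤ K) →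
        ∀ᵐ ω ∂P, ∀ ε > 0, ∀ᶠ n : ℕ in atTop,
          |∑ k ∈ Finset.range n, f k (ω k) - ∑ k ∈ Finset.range n, bmean v k (f k)| ≤ ε * n := by
  let coin : ℕ → Measure Bool := fun k =>
    ENNReal.ofReal (v k) • Measure.dirac false + ENNReal.ofReal (1 - v k) • Measure.dirac true
  have hcoin : ∀ k, IsProbabilityMeasure (coin k) := fun k => ⟨by
    simp only [coin, Measure.add_apply, Measure.smul_apply, measure_univ, smul_eq_mul, mul_one]
    rw [← ENNReal.ofReal_add (hv0 k).le (by linarith [hv1 k]), add_sub_cancel, ENNReal.ofReal_one]⟩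
  have hcoin : ∀ k (g : Bool → ℝ), ∫ b, g b ∂(coin k) = bmean v k g := by
    intro k g
    have hi : ∀ (a : ENNReal) (b : Bool), a ≠ ⊤ → Integrable g (a • Measure.dirac b) :=
      fun a b ha => (integrable_dirac (by simp [enorm_lt_top])).smul_measure ha
    rw [integral_add_measure (hi _ _ ENNReal.ofReal_ne_top) (hi _ _ ENNReal.ofReal_ne_top),
      integral_smul_measure, integral_smul_measure, integral_dirac, integral_dirac,
      ENNReal.toReal_ofReal (hv0 k).le, ENNReal.toReal_ofReal (by linarith [hv1 k])]
    rfl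
  refine ⟨Measure.infinitePi coin, inferInstance, fun ω n => ?_, fun f K hf => ?_⟩
  · have h1 : {ω' : ℕ → Bool | ∀ k < n, ω' k = ω k} =
        Set.pi (Finset.range n : Set ℕ) (fun k => {ω k}) := by
      ext ω'
      simp
    rw [h1, Measure.infinitePi_pi _ (fun _ _ => measurableSet_singleton _), bmass,
      ENNReal.ofReal_prod_of_nonneg (fun k _ => (bwt_nonneg hv0 hv1 _ _).le)]
    refine Finset.prod_congr rfl fun k _ => ?_
    simp only [coin, bwt]
    cases ω k <;> simp
  · have hmean : ∀ k, |bmean v k (f k)| ≤ K := by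
      intro k
      have h1 := abs_le.1 (hf k false)
      have h2 := abs_le.1 (hf k true)
      have h3 := hv0 k
      have h4 := hv1 k
      rw [bmean, abs_le]
      constructor <;> nlinarith
    have hK : 0 ≤ K := (abs_nonneg _).trans (hf 0 false)
    have hmeas : ∀ k, Measurable (fun b : Bool => f k b - bmean v k (f k)) := fun k =>
      measurable_of_countable _
    have key := ae_tendsto_average (P := Measure.infinitePi coin)
      (X := fun k ω => f k (ω k) - bmean v k (f k))
      (fun k => (hmeas k).comp (measurable_pi_apply k))
      (iIndepFun_infinitePi (X := fun k b => f k b - bmean v k (f k)) hmeas)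
      (K := 2 * K + 1) (by linarith)
      (fun k ω => by
        have h1 := abs_le.1 (hf k (ω k))
        have h2 := abs_le.1 (hmean k)
        constructor <;> linarith)
      (fun k => by
        have h1 := integral_map (μ := Measure.infinitePi coin) (f := fun b => f k b - bmean v k (f k))
          (measurable_pi_apply k).aemeasurable (hmeas k).aestronglyMeasurable
        rw [Measure.infinitePi_map_eval coin k, hcoin] at h1
        rw [← h1]
        simp only [bmean]
        ring)
    filter_upwards [key] with ω hω ε hε
    simpa only [Finset.sum_sub_distrib] using hω ε hε

end LargeNumbers

section Lower

variable {c : ℕ → ℝ} {B : ℝ} {v : ℕ → ℝ}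

theorem le_dimH_image_of_bmass_le (hB : 2 < B) (hc : ∀ k, B ≤ c (k + 1))
    {P : Measure (ℕ → Bool)} [IsProbabilityMeasure P]
    (hP : ∀ ω n, P {ω' | ∀ k < n, ω' k = ω k} = ENNReal.ofReal (bmass v ω n))
    {G : Set (ℕ → Bool)} {d : ℝ} (hd : 0 < d)
    (hG : ∀ᵐ ω ∂P, ω ∈ G ∧ ∀ᶠ n in atTop, bmass v ω n ≤ ((1 - 2 / B) * mlen c n) ^ d) :
    ENNReal.ofReal d ≤ dimH (proj c '' G) := by
  have hδ : ∀ n, 0 < (1 - 2 / B) * mlen c n := fun n => mul_pos (sep_pos hB) (mlen_pos hB hc n)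
  let F : ℕ → Set (ℕ → Bool) := fun m =>
    {ω | ω ∈ G ∧ ∀ n ≥ m, bmass v ω n ≤ ((1 - 2 / B) * mlen c n) ^ d}
  obtain ⟨m, hm⟩ : ∃ m, P (F m) ≠ 0 := by
    by_contra! h
    have h1 : P (⋃ m, F m) = 0 := measure_iUnion_null h
    have h2 : ∀ᵐ ω ∂P, ω ∈ ⋃ m, F m := by
      filter_upwards [hG] with ω ⟨hω, he⟩
      obtain ⟨m, hm⟩ := eventually_atTop.1 he
      exact mem_iUnion.2 ⟨m, hω, hm⟩
    have h3 : ∀ᵐ ω ∂P, False := by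
      filter_upwards [h2, measure_eq_zero_iff_ae_notMem.1 h1] with ω a b using b a
    have h4 : P univ = 0 := by simpa using ae_iff.1 h3
    simp at h4
  set ν := P.map (proj c) with hν
  have hmint : ∀ ω n, ν (mint c ω n) ≤ ENNReal.ofReal (bmass v ω n) := by
    intro ω n
    rw [hν, Measure.map_apply (measurable_proj c) (measurableSet_mint c ω n), ← hP]
    exact measure_mono fun ω' hω' => eq_of_mem_mint hB hc (proj_mem hB hc ω' n) hω'
  have hle : ν.restrict (proj c '' F m) ≤ Measure.hausdorffMeasure d := by
    refine Measure.le_hausdorffMeasure d _ (ENNReal.ofReal ((1 - 2 / B) * mlen c m / 2))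
      (ENNReal.ofReal_pos.2 (half_pos (hδ m))) fun s hs => ?_
    refine (measure_mono subset_closure).trans ?_
    rw [Measure.restrict_apply isClosed_closure.measurableSet, ← ediam_closure]
    rw [← ediam_closure] at hs
    generalize closure s = s at hs
    rcases (s ∩ proj c '' F m).eq_empty_or_nonempty with h0 | ⟨_, hxs, ω, ⟨hωG, hω⟩, rfl⟩
    · rw [h0, measure_empty]
      exact zero_le
    have hfin : ediam s ≠ ⊤ := ne_top_of_le_ne_top ENNReal.ofReal_ne_top hs
    have hρm : diam s < (1 - 2 / B) * mlen c m := by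
      have : diam s ≤ (1 - 2 / B) * mlen c m / 2 :=
        ENNReal.toReal_le_of_le_ofReal (half_pos (hδ m)).le hs
      linarith [hδ m]
    have hsub : ∀ n, diam s < (1 - 2 / B) * mlen c n → m ≤ n + 1 →
        ν (s ∩ proj c '' F m) ≤ ENNReal.ofReal (((1 - 2 / B) * mlen c (n + 1)) ^ d) := by
      intro n hn hmn
      refine (measure_mono ?_).trans ((hmint ω (n + 1)).trans
        (ENNReal.ofReal_le_ofReal (hω _ hmn)))
      rintro _ ⟨hys, ω', -, rfl⟩
      rw [mint_congr c (eq_of_close hB hc (proj_mem hB hc ω (n + 1)) (proj_mem hB hc ω' (n + 1))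
        ((dist_le_diam_of_mem' hfin hxs hys).trans_lt hn))]
      exact proj_mem hB hc ω' (n + 1)
    have hdiam : ediam s = ENNReal.ofReal (diam s) := (ENNReal.ofReal_toReal hfin).symm
    rcases (diam_nonneg (s := s)).eq_or_lt with h0 | h0
    · rw [hdiam, ← h0, ENNReal.ofReal_zero, ENNReal.zero_rpow_of_pos hd]
      have ht : Tendsto (fun n => ENNReal.ofReal (((1 - 2 / B) * mlen c (n + 1)) ^ d)) atTop
          (𝓝 0) := by
        have h1 : Tendsto (fun n => (1 - 2 / B) * mlen c (n + 1)) atTop (𝓝 0) := by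
          simpa using ((tendsto_mlen hB hc).comp (tendsto_add_atTop_nat 1)).const_mul (1 - 2 / B)
        have h2 := ENNReal.tendsto_ofReal (h1.rpow_const (Or.inr hd.le))
        rwa [Real.zero_rpow hd.ne', ENNReal.ofReal_zero] at h2
      refine ge_of_tendsto ht (eventually_atTop.2 ⟨m, fun n hn => hsub n ?_ (by omega)⟩)
      rw [← h0]
      exact hδ n
    · obtain ⟨n, hmn, hn1, hn2⟩ := exists_scale hB hc h0 m hρm
      refine (hsub n hn2 (by omega)).trans ?_
      rw [hdiam, ENNReal.ofReal_rpow_of_pos h0]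
      exact ENNReal.ofReal_le_ofReal (Real.rpow_le_rpow (hδ _).le hn1 hd.le)
  have hpos : Measure.hausdorffMeasure d (proj c '' F m) ≠ 0 := by
    intro h0
    have h1 := hle (proj c '' F m)
    rw [h0, Measure.restrict_apply_self] at h1
    have h2 := Measure.le_map_apply (μ := P) (measurable_proj c).aemeasurable (proj c '' F m)
    exact hm (le_antisymm ((measure_mono (subset_preimage_image _ _)).trans (h2.trans h1))
      zero_le)
  have hcoe : (d.toNNReal : ℝ) = d := Real.coe_toNNReal _ hd.le
  exact (le_dimH_of_hausdorffMeasure_ne_zero (d := d.toNNReal) (by rwa [hcoe])).trans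
    (dimH_mono (image_mono fun ω (hω : ω ∈ F m) => hω.1))

/-- A mass distribution principle: the image under `proj` of a set of full measure, almost all
of whose points have lower symbolic dimension at least `d`, has dimension at least `d`. -/
theorem le_dimH_image (hB : 2 < B) (hc : ∀ k, B ≤ c (k + 1))
    (hv0 : ∀ k, 0 < v k) (hv1 : ∀ k, v k < 1)
    {P : Measure (ℕ → Bool)} [IsProbabilityMeasure P]
    (hP : ∀ ω n, P {ω' | ∀ k < n, ω' k = ω k} = ENNReal.ofReal (bmass v ω n))
    {G : Set (ℕ → Bool)} {d : ℝ}
    (hG : ∀ᵐ ω ∂P, ω ∈ G ∧ ∀ ε > 0, ∀ᶠ n in atTop, (d - ε) * logLen c n ≤ logMass v ω n) :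
    ENNReal.ofReal d ≤ dimH (proj c '' G) := by
  refine ENNReal.le_of_forall_pos_le_add fun ε hε _ => ?_
  rcases le_or_gt (d - ε) 0 with h0 | h0
  · have : ENNReal.ofReal d ≤ ε := by
      rw [← ENNReal.ofReal_coe_nnreal]
      exact ENNReal.ofReal_le_ofReal (by linarith)
    exact this.trans le_add_self
  have hε' : (0 : ℝ) < ε := hε
  have key : ENNReal.ofReal (d - ε) ≤ dimH (proj c '' G) := by
    refine le_dimH_image_of_bmass_le hB hc hP h0 ?_
    filter_upwards [hG] with ω ⟨hω, he⟩
    refine ⟨hω, ?_⟩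
    filter_upwards [he (ε / 2) (by positivity),
      ((tendsto_logLen hB hc).const_mul_atTop (show (0 : ℝ) < ε / 2 by positivity)).eventually_ge_atTop
        (-((d - ε) * Real.log (1 - 2 / B)))] with n hn1 hn2
    rw [bmass_eq_exp hv0 hv1, Real.rpow_def_of_pos (mul_pos (sep_pos hB) (mlen_pos hB hc n)),
      Real.log_mul (sep_pos hB).ne' (mlen_pos hB hc n).ne', log_mlen hB hc, Real.exp_le_exp]
    linarith
  calc ENNReal.ofReal d = ENNReal.ofReal (d - ε + ε) := by rw [sub_add_cancel]
    _ ≤ ENNReal.ofReal (d - ε) + ENNReal.ofReal ε := ENNReal.ofReal_add_le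
    _ ≤ _ := by rw [ENNReal.ofReal_coe_nnreal]; exact add_le_add_left key _

end Lower

section Averages

variable {c : ℕ → ℝ} {B : ℝ} {v : ℕ → ℝ}

theorem abs_neg_log_bwt_le {v₀ : ℝ} (hv₀ : 0 < v₀) (h1 : ∀ k, v₀ ≤ v k) (h2 : ∀ k, v k ≤ 1 - v₀)
    (k : ℕ) (b : Bool) : |-Real.log (bwt v k b)| ≤ -Real.log v₀ := by
  have h3 : v₀ ≤ bwt v k b := by
    cases b <;> simp only [bwt] <;> simp <;> linarith [h1 k, h2 k]
  have h4 : bwt v k b ≤ 1 := by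
    cases b <;> simp only [bwt] <;> simp <;> linarith [h1 k, h2 k]
  rw [abs_of_nonneg (neg_nonneg.2 (Real.log_nonpos (hv₀.le.trans h3) h4)), neg_le_neg_iff]
  exact Real.log_le_log hv₀ h3

theorem logMass_le_mul_logLen (hB : 2 < B) (hc : ∀ k, B ≤ c (k + 1)) {v₀ : ℝ} (hv₀ : 0 < v₀)
    (h1 : ∀ k, v₀ ≤ v k) (h2 : ∀ k, v k ≤ 1 - v₀) (ω : ℕ → Bool) (n : ℕ) :
    logMass v ω n ≤ -Real.log v₀ / Real.log B * logLen c n := by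
  have hB' := log_ratio_pos hB
  have h3 : logMass v ω n ≤ n * -Real.log v₀ := by
    have := Finset.sum_le_card_nsmul (Finset.range n) (fun k => -Real.log (bwt v k (ω k)))
      (-Real.log v₀) fun k _ => (le_abs_self _).trans (abs_neg_log_bwt_le hv₀ h1 h2 k _)
    simpa [logMass] using this
  have h0 : 0 ≤ -Real.log v₀ :=
    (abs_nonneg _).trans (abs_neg_log_bwt_le hv₀ h1 h2 0 false)
  calc logMass v ω n ≤ n * -Real.log v₀ := h3
    _ = -Real.log v₀ / Real.log B * (n * Real.log B) := by field_simp
    _ ≤ _ := mul_le_mul_of_nonneg_left (mul_le_logLen hB hc n) (by positivity)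

variable {μ : Measure ℝ} [IsProbabilityMeasure μ] {R : ℕ → ℝ}

/-- Lower bound for a level set, tested on an inhomogeneous Bernoulli measure with weights `v`. -/
theorem le_dimH_lowerLocalDim_eq (hB : 2 < B) (hc : ∀ k, B ≤ c (k + 1))
    {R₀ : ℝ} (hR₀ : 0 < R₀) (hR1 : ∀ k, R₀ ≤ R k) (hR2 : ∀ k, R k ≤ 1 - R₀)
    (hμ : ∀ ω n, μ (mint c ω n) = ENNReal.ofReal (bmass R ω n))
    {v₀ : ℝ} (hv₀ : 0 < v₀) (hv1 : ∀ k, v₀ ≤ v k) (hv2 : ∀ k, v k ≤ 1 - v₀)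
    {α d : ℝ} (hα : 0 < α)
    (h1 : ∀ ε > 0, ∀ᶠ n in atTop, (α - ε) * logLen c n ≤
      ∑ k ∈ Finset.range n, bmean v k (fun b => -Real.log (bwt R k b)))
    (h2 : ∀ ε > 0, ∃ᶠ n in atTop,
      ∑ k ∈ Finset.range n, bmean v k (fun b => -Real.log (bwt R k b)) ≤ (α + ε) * logLen c n)
    (h3 : ∀ ε > 0, ∀ᶠ n in atTop, (d - ε) * logLen c n ≤
      ∑ k ∈ Finset.range n, bmean v k (fun b => -Real.log (bwt v k b))) :
    ENNReal.ofReal d ≤ dimH {x | x ∈ moranSet c ∧ lowerLocalDim μ x = α} := by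
  have hB' := log_ratio_pos hB
  have hv0' : ∀ k, 0 < v k := fun k => hv₀.trans_le (hv1 k)
  have hv1' : ∀ k, v k < 1 := fun k => by linarith [hv2 k]
  have hR0' : ∀ k, 0 < R k := fun k => hR₀.trans_le (hR1 k)
  have hR1' : ∀ k, R k < 1 := fun k => by linarith [hR2 k]
  obtain ⟨P, _, hP, hlln⟩ := exists_bernoulli_measure hv0' hv1'
  have hlarge : ∀ ε > 0, ∀ n : ℕ, ε * Real.log B * n ≤ ε * logLen c n := fun ε hε n => by
    have := mul_le_mul_of_nonneg_left (mul_le_logLen hB hc n) (le_of_lt hε)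
    linarith
  have hG : ∀ᵐ ω ∂P, ω ∈ {ω | (∀ ε > 0, ∀ᶠ n in atTop, (α - ε) * logLen c n ≤ logMass R ω n) ∧
      (∀ ε > 0, ∃ᶠ n in atTop, logMass R ω n ≤ (α + ε) * logLen c n)} ∧
      ∀ ε > 0, ∀ᶠ n in atTop, (d - ε) * logLen c n ≤ logMass v ω n := by
    filter_upwards [hlln (fun k b => -Real.log (bwt R k b)) _ (abs_neg_log_bwt_le hR₀ hR1 hR2),
      hlln (fun k b => -Real.log (bwt v k b)) _ (abs_neg_log_bwt_le hv₀ hv1 hv2)] with ω hω1 hω2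
    refine ⟨⟨fun ε hε => ?_, fun ε hε => ?_⟩, fun ε hε => ?_⟩
    · filter_upwards [hω1 (ε / 2 * Real.log B) (by positivity), h1 (ε / 2) (by positivity)]
        with n a b
      have := hlarge (ε / 2) (by positivity) n
      have := (abs_le.1 a).1
      rw [logMass]
      linarith
    · refine ((h2 (ε / 2) (by positivity)).and_eventually
        (hω1 (ε / 2 * Real.log B) (by positivity))).mono fun n ⟨a, b⟩ => ?_
      have := hlarge (ε / 2) (by positivity) n
      have := (abs_le.1 b).2
      rw [logMass]
      linarith
    · filter_upwards [hω2 (ε / 2 * Real.log B) (by positivity), h3 (ε / 2) (by positivity)]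
        with n a b
      have := hlarge (ε / 2) (by positivity) n
      have := (abs_le.1 a).1
      rw [logMass]
      linarith
  refine (le_dimH_image hB hc hv0' hv1' hP hG).trans (dimH_mono ?_)
  rintro _ ⟨ω, ⟨a, b⟩, rfl⟩
  exact ⟨proj_mem_moranSet hB hc ω, (lowerLocalDim_eq_iff hB hc hR0' hR1' hμ
    (logMass_le_mul_logLen hB hc hR₀ hR1 hR2 ω) (proj_mem hB hc ω) hα).2 ⟨a, b⟩⟩

/-- Upper bound for a level set: the points are covered using cylinders for the weights `v`. -/
theorem dimH_lowerLocalDim_eq_le (hB : 2 < B) (hc : ∀ k, B ≤ c (k + 1))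
    {R₀ : ℝ} (hR₀ : 0 < R₀) (hR1 : ∀ k, R₀ ≤ R k) (hR2 : ∀ k, R k ≤ 1 - R₀)
    (hμ : ∀ ω n, μ (mint c ω n) = ENNReal.ofReal (bmass R ω n))
    (hv0 : ∀ k, 0 < v k) (hv1 : ∀ k, v k < 1) {α d : ℝ} (hα : 0 < α) (hd : 0 ≤ d)
    (h : ∀ ω, (∀ ε > 0, ∀ᶠ n in atTop, (α - ε) * logLen c n ≤ logMass R ω n) →
      (∀ ε > 0, ∃ᶠ n in atTop, logMass R ω n ≤ (α + ε) * logLen c n) →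
      ∀ ε > 0, ∃ᶠ n in atTop, logMass v ω n ≤ (d + ε) * logLen c n) :
    dimH {x | x ∈ moranSet c ∧ lowerLocalDim μ x = α} ≤ ENNReal.ofReal d := by
  refine dimH_le_of_frequently hB hc hv0 hv1 hd ?_
  rintro x ⟨hx, hxα⟩
  obtain ⟨ω, hω⟩ := (mem_moranSet_iff hB hc x).1 hx
  obtain ⟨a, b⟩ := (lowerLocalDim_eq_iff hB hc (fun k => hR₀.trans_le (hR1 k))
    (fun k => by linarith [hR2 k]) hμ (logMass_le_mul_logLen hB hc hR₀ hR1 hR2 ω) hω hα).1 hxα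
  exact ⟨ω, hω, h ω a b⟩

end Averages

section Blocks

/-- The levels `k` lying in a block `[N (2i), N (2i+1))`. -/
def evenBlock (N : ℕ → ℕ) (k : ℕ) : Prop := ∃ i, N (2 * i) ≤ k ∧ k < N (2 * i + 1)

/-- The levels lying in the initial part of length `⌊t * N (2i)⌋` of a block
`[N (2i), N (2i+1))`. -/
def earlyBlock (N : ℕ → ℕ) (t : ℝ) (k : ℕ) : Prop :=
  ∃ i, N (2 * i) ≤ k ∧ k < N (2 * i + 1) ∧ k < N (2 * i) + ⌊t * N (2 * i)⌋₊

theorem evenBlock_of_earlyBlock {N : ℕ → ℕ} {t : ℝ} {k : ℕ} (h : earlyBlock N t k) :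
    evenBlock N k := by
  obtain ⟨i, h1, h2, -⟩ := h
  exact ⟨i, h1, h2⟩

theorem sum_range_le_add {x : ℕ → ℝ} {C : ℝ} {m n : ℕ} (hmn : m ≤ n)
    (h : ∀ k, m ≤ k → k < n → x k ≤ C) :
    ∑ k ∈ Finset.range n, x k ≤ ∑ k ∈ Finset.range m, x k + C * (n - m) := by
  induction n, hmn using Nat.le_induction with
  | base => simp
  | succ n hmn ih =>
    rw [Finset.sum_range_succ]
    have h1 := ih fun k hk hk' => h k hk (by omega)
    have h2 := h n hmn (by omega)
    push_cast
    linarith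

theorem add_le_sum_range {x : ℕ → ℝ} {C : ℝ} {m n : ℕ} (hmn : m ≤ n)
    (h : ∀ k, m ≤ k → k < n → C ≤ x k) :
    ∑ k ∈ Finset.range m, x k + C * (n - m) ≤ ∑ k ∈ Finset.range n, x k := by
  have := sum_range_le_add (x := fun k => -x k) (C := -C) hmn fun k h1 h2 => neg_le_neg (h k h1 h2)
  simp only [Finset.sum_neg_distrib] at this
  linarith

variable {N : ℕ → ℕ}

theorem exists_block (hN0 : N 0 = 0) (hN : StrictMono N) (k : ℕ) :
    ∃ i, N i ≤ k ∧ k < N (i + 1) := by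
  have hex : ∃ i, k < N (i + 1) := ⟨k, (Nat.lt_succ_self k).trans_le (hN.id_le _)⟩
  classical
  refine ⟨Nat.find hex, ?_, Nat.find_spec hex⟩
  rcases h : Nat.find hex with _ | i
  · omega
  · exact not_lt.1 (Nat.find_min hex (m := i) (by omega))

theorem exists_oddBlock (hN0 : N 0 = 0) (hN : StrictMono N) {k : ℕ} (hk : ¬ evenBlock N k) :
    ∃ i, N (2 * i + 1) ≤ k ∧ k < N (2 * i + 2) := by
  obtain ⟨i, h1, h2⟩ := exists_block hN0 hN k
  rcases Nat.even_or_odd' i with ⟨j, rfl | rfl⟩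
  · exact absurd ⟨j, h1, h2⟩ hk
  · exact ⟨j, h1, h2⟩

theorem not_evenBlock (hN : StrictMono N) {j k : ℕ} (h1 : N (2 * j + 1) ≤ k)
    (h2 : k < N (2 * j + 2)) : ¬ evenBlock N k := by
  rintro ⟨i, h3, h4⟩
  have := hN.lt_iff_lt.1 (h1.trans_lt h4)
  have := hN.lt_iff_lt.1 (h3.trans_lt h2)
  omega

theorem eventually_mul_le_succ (hN : StrictMono N)
    (hlim : Tendsto (fun i : ℕ => (N (i + 1) : ℝ) / (N i : ℝ)) atTop atTop) (C : ℝ) :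
    ∀ᶠ i in atTop, C * N i ≤ N (i + 1) := by
  filter_upwards [hlim.eventually_ge_atTop C, eventually_ge_atTop 1] with i hi h1
  have : 0 < N i := (Nat.zero_le _).trans_lt (hN (show 0 < i by omega))
  exact (le_div_iff₀ (by exact_mod_cast this)).1 hi

theorem tendsto_two_mul_add (a : ℕ) : Tendsto (fun i : ℕ => 2 * i + a) atTop atTop :=
  tendsto_atTop_mono (fun i => show i ≤ 2 * i + a by omega) tendsto_id

/-- A bounded sequence vanishing on the even blocks has negligible partial sums at the end of
these blocks. -/
theorem frequently_abs_sum_le (hN : StrictMono N)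
    (hlim : Tendsto (fun i : ℕ => (N (i + 1) : ℝ) / (N i : ℝ)) atTop atTop)
    {x : ℕ → ℝ} {K : ℝ} (hK : ∀ k, |x k| ≤ K) (hx : ∀ k, evenBlock N k → x k = 0)
    {ε : ℝ} (hε : 0 < ε) : ∃ᶠ n : ℕ in atTop, |∑ k ∈ Finset.range n, x k| ≤ ε * n := by
  have h1 := (tendsto_two_mul_add 0).eventually (eventually_mul_le_succ hN hlim (K / ε))
  have ht : Tendsto (fun i => N (2 * i + 1)) atTop atTop :=
    hN.tendsto_atTop.comp (tendsto_two_mul_add 1)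
  refine ht.frequently (Eventually.frequently ?_)
  filter_upwards [h1] with i hi
  have h2 : K * N (2 * i) ≤ ε * N (2 * i + 1) := by
    have := mul_le_mul_of_nonneg_left hi hε.le
    rwa [← mul_assoc, mul_div_cancel₀ _ hε.ne'] at this
  have hle : N (2 * i) ≤ N (2 * i + 1) := (hN (by omega)).le
  have h0 : ∀ k, N (2 * i) ≤ k → k < N (2 * i + 1) → x k = 0 := fun k a b => hx k ⟨i, a, b⟩
  have a1 := sum_range_le_add (x := x) hle fun k a b => (h0 k a b).le
  have a2 := add_le_sum_range (x := x) hle fun k a b => (h0 k a b).ge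
  have b1 := sum_range_le_add (x := x) (Nat.zero_le (N (2 * i)))
    fun k _ _ => (abs_le.1 (hK k)).2
  have b2 := add_le_sum_range (x := x) (Nat.zero_le (N (2 * i)))
    fun k _ _ => (abs_le.1 (hK k)).1
  simp only [Finset.range_zero, Finset.sum_empty, Nat.cast_zero] at b1 b2
  rw [abs_le]
  constructor <;> linarith

variable {e : ℕ → ℝ} {β γ t : ℝ}

theorem eventually_le_sum_earlyBlock (hN0 : N 0 = 0) (hN : StrictMono N)
    (hlim : Tendsto (fun i : ℕ => (N (i + 1) : ℝ) / (N i : ℝ)) atTop atTop)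
    (hβ : 0 < β) (hγ : 0 < γ) (ht : γ * t = β)
    (hodd : ∀ k, ¬ evenBlock N k → β ≤ e k) (hearly : ∀ k, earlyBlock N t k → -γ ≤ e k)
    (hlate : ∀ k, evenBlock N k → ¬ earlyBlock N t k → 0 ≤ e k) {ε : ℝ} (hε : 0 < ε) :
    ∀ᶠ n : ℕ in atTop, -(ε * n) ≤ ∑ k ∈ Finset.range n, e k := by
  have ht0 : 0 ≤ t := by
    by_contra! h
    nlinarith
  have hge : ∀ k, -γ ≤ e k := by
    intro k
    by_cases h1 : evenBlock N k
    · by_cases h2 : earlyBlock N t k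
      · exact hearly k h2
      · linarith [hlate k h1 h2]
    · linarith [hodd k h1]
  have hnot : ∀ k, ¬ earlyBlock N t k → 0 ≤ e k := fun k hk => by
    by_cases h1 : evenBlock N k
    · exact hlate k h1 hk
    · exact hβ.le.trans (hodd k h1)
  obtain ⟨i₀, hi₀⟩ := eventually_atTop.1 (eventually_mul_le_succ hN hlim ((β + γ) / ε))
  filter_upwards [eventually_ge_atTop (N (2 * i₀ + 2))] with n hn
  obtain ⟨j, hj, hj1, hj2⟩ : ∃ j, i₀ ≤ j ∧ N (2 * j + 2) ≤ n ∧ n < N (2 * j + 4) := by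
    obtain ⟨i, h1, h2⟩ := exists_block hN0 hN n
    have := hN.lt_iff_lt.1 (hn.trans_lt h2)
    rcases Nat.even_or_odd' i with ⟨j, rfl | rfl⟩
    · refine ⟨j - 1, by omega, ?_, ?_⟩
      · convert h1 using 2; omega
      · exact h2.trans_le (hN.monotone (by omega))
    · refine ⟨j - 1, by omega, ?_, ?_⟩
      · exact (hN.monotone (by omega)).trans h1
      · convert h2 using 2; omega
  have hratio : (β + γ) * N (2 * j + 1) ≤ ε * N (2 * j + 2) := by
    have := mul_le_mul_of_nonneg_left (hi₀ (2 * j + 1) (by omega)) hε.le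
    rwa [← mul_assoc, mul_div_cancel₀ _ hε.ne'] at this
  have hstart : -γ * N (2 * j + 1) + β * (N (2 * j + 2) - N (2 * j + 1)) ≤
      ∑ k ∈ Finset.range (N (2 * j + 2)), e k := by
    have b1 := add_le_sum_range (x := e) (Nat.zero_le (N (2 * j + 1))) fun k _ _ => hge k
    have b2 := add_le_sum_range (x := e) (hN (show 2 * j + 1 < 2 * j + 2 by omega)).le
      fun k h1 h2 => hodd k (not_evenBlock hN h1 h2)
    simp only [Finset.range_zero, Finset.sum_empty, Nat.cast_zero] at b1
    linarith
  have hfloor : γ * ⌊t * N (2 * j + 2)⌋₊ ≤ β * N (2 * j + 2) := by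
    have := mul_le_mul_of_nonneg_left (Nat.floor_le (mul_nonneg ht0 (Nat.cast_nonneg (N (2 * j + 2)))))
      hγ.le
    rwa [← mul_assoc, ht] at this
  have hmid : ∀ m, N (2 * j + 2) ≤ m → m ≤ N (2 * j + 2) + ⌊t * N (2 * j + 2)⌋₊ →
      -((β + γ) * N (2 * j + 1)) ≤ ∑ k ∈ Finset.range m, e k := by
    intro m h1 h2
    have b := add_le_sum_range (x := e) h1 fun k _ _ => hge k
    have h3 : (m : ℝ) ≤ N (2 * j + 2) + ⌊t * N (2 * j + 2)⌋₊ := by exact_mod_cast h2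
    have h4 := mul_le_mul_of_nonneg_left h3 hγ.le
    linarith
  have hmain : -((β + γ) * N (2 * j + 1)) ≤ ∑ k ∈ Finset.range n, e k := by
    rcases le_total n (N (2 * j + 2) + ⌊t * N (2 * j + 2)⌋₊) with h | h
    · exact hmid n hj1 h
    · refine (hmid _ (Nat.le_add_right _ _) le_rfl).trans ?_
      have b := add_le_sum_range (x := e) (C := 0) h fun k h1 h2 => hnot k (by
        rintro ⟨i, h3, h4, h5⟩
        have := hN.lt_iff_lt.1 (h3.trans_lt (h2.trans hj2))
        have := hN.lt_iff_lt.1 (((Nat.le_add_right _ _).trans h1).trans_lt h4)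
        obtain rfl : i = j + 1 := by omega
        exact absurd h5 (not_lt.2 h1))
      linarith
  have : ε * N (2 * j + 2) ≤ ε * n := mul_le_mul_of_nonneg_left (by exact_mod_cast hj1) hε.le
  linarith

theorem frequently_sum_earlyBlock_le (hN : StrictMono N)
    (hlim : Tendsto (fun i : ℕ => (N (i + 1) : ℝ) / (N i : ℝ)) atTop atTop)
    (hβ : 0 < β) (hγ : 0 < γ) (ht : γ * t = β) {K : ℝ} (hK : ∀ k, e k ≤ K)
    (hodd : ∀ k, ¬ evenBlock N k → e k ≤ β) (hearly : ∀ k, earlyBlock N t k → e k ≤ -γ)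
    {ε : ℝ} (hε : 0 < ε) :
    ∃ᶠ n : ℕ in atTop, ∑ k ∈ Finset.range n, e k ≤ ε * n := by
  have ht0 : 0 ≤ t := by
    by_contra! h
    nlinarith
  have h1 := (tendsto_two_mul_add 1).eventually (eventually_mul_le_succ hN hlim (2 * |K| / ε))
  have h2 := (tendsto_two_mul_add 2).eventually (eventually_mul_le_succ hN hlim (1 + t))
  have htend : Tendsto (fun i => N (2 * i + 2)) atTop atTop :=
    hN.tendsto_atTop.comp (tendsto_two_mul_add 2)
  have h3 := ((tendsto_natCast_atTop_atTop (R := ℝ)).comp htend).eventually_ge_atTop (2 * γ / ε)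
  have ht' : Tendsto (fun i => N (2 * i + 2) + ⌊t * N (2 * i + 2)⌋₊) atTop atTop :=
    tendsto_atTop_mono (fun i => Nat.le_add_right _ _) htend
  refine ht'.frequently (Eventually.frequently ?_)
  filter_upwards [h1, h2, h3] with j hj1 hj2 hj3
  have hfl := Nat.floor_le (mul_nonneg ht0 (Nat.cast_nonneg (α := ℝ) (N (2 * j + 2))))
  have hfl' := (Nat.lt_floor_add_one (t * N (2 * j + 2))).le
  have hle : N (2 * j + 2) + ⌊t * N (2 * j + 2)⌋₊ ≤ N (2 * j + 3) := by
    have : (N (2 * j + 2) : ℝ) + ⌊t * N (2 * j + 2)⌋₊ ≤ N (2 * j + 3) := by linarith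
    exact_mod_cast this
  have b1 := sum_range_le_add (x := e) (Nat.zero_le (N (2 * j + 1)))
    fun k _ _ => (hK k).trans (le_abs_self K)
  have b2 := sum_range_le_add (x := e) (hN (show 2 * j + 1 < 2 * j + 2 by omega)).le
    fun k h1 h2 => hodd k (not_evenBlock hN h1 h2)
  have b3 := sum_range_le_add (x := e) (Nat.le_add_right (N (2 * j + 2)) ⌊t * N (2 * j + 2)⌋₊)
    fun k h1 h2 => hearly k ⟨j + 1, h1, h2.trans_le hle, h2⟩
  simp only [Finset.range_zero, Finset.sum_empty, Nat.cast_zero] at b1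
  push_cast at b3 ⊢
  have c1 : 2 * |K| * N (2 * j + 1) ≤ ε * N (2 * j + 2) := by
    have := mul_le_mul_of_nonneg_left hj1 hε.le
    rwa [← mul_assoc, mul_div_cancel₀ _ hε.ne'] at this
  have c2 : 2 * γ ≤ ε * N (2 * j + 2) := by
    have := mul_le_mul_of_nonneg_left hj3 hε.le
    rwa [mul_div_cancel₀ _ hε.ne'] at this
  have c3 := mul_le_mul_of_nonneg_left hfl' hγ.le
  rw [← mul_assoc, ht] at c3
  have c3' : β * N (2 * j + 2) ≤ γ * ⌊t * N (2 * j + 2)⌋₊ + γ := by linarith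
  have c4 : 0 ≤ ε * (⌊t * N (2 * j + 2)⌋₊ : ℝ) := by positivity
  have c5 : 0 ≤ β * (N (2 * j + 1) : ℝ) := by positivity
  linarith

end Blocks

section Weights

/-- The weight of the first letter in the Gibbs state with parameter `s`. -/
noncomputable def gibbsWeight (p s : ℝ) : ℝ := p ^ s / (p ^ s + (1 - p) ^ s)

/-- The local dimension contributed by frequency `u` of the first letter. -/
noncomputable def freqDim (p A u : ℝ) : ℝ :=
  (u * -Real.log p + (1 - u) * -Real.log (1 - p)) / Real.log A

theorem neg_betaFn (p : ℝ) {A : ℝ} (hA : 1 < A) (s : ℝ) :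
    -betaFn p A s * Real.log A = Real.log (p ^ s + (1 - p) ^ s) := by
  have := (Real.log_pos hA).ne'
  rw [betaFn]
  field_simp

variable {p : ℝ}

theorem one_sub_gibbsWeight (hp0 : 0 < p) (hp1 : p < 1) (s : ℝ) :
    1 - gibbsWeight p s = (1 - p) ^ s / (p ^ s + (1 - p) ^ s) := by
  have h1 := Real.rpow_pos_of_pos hp0 s
  have h2 := Real.rpow_pos_of_pos (sub_pos.2 hp1) s
  rw [gibbsWeight]
  field_simp
  ring

theorem gibbsWeight_pos (hp0 : 0 < p) (hp1 : p < 1) (s : ℝ) : 0 < gibbsWeight p s := by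
  have h1 := Real.rpow_pos_of_pos hp0 s
  have h2 := Real.rpow_pos_of_pos (sub_pos.2 hp1) s
  rw [gibbsWeight]
  positivity

theorem gibbsWeight_lt_one (hp0 : 0 < p) (hp1 : p < 1) (s : ℝ) : gibbsWeight p s < 1 := by
  have h1 := Real.rpow_pos_of_pos hp0 s
  have h2 := Real.rpow_pos_of_pos (sub_pos.2 hp1) s
  rw [← sub_pos, one_sub_gibbsWeight hp0 hp1]
  positivity

theorem neg_log_gibbsWeight (hp0 : 0 < p) (hp1 : p < 1) (s : ℝ) :
    -Real.log (gibbsWeight p s) = s * -Real.log p + Real.log (p ^ s + (1 - p) ^ s) := by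
  have h1 := Real.rpow_pos_of_pos hp0 s
  have h2 := Real.rpow_pos_of_pos (sub_pos.2 hp1) s
  rw [gibbsWeight, Real.log_div h1.ne' (by positivity), Real.log_rpow hp0]
  ring

theorem neg_log_one_sub_gibbsWeight (hp0 : 0 < p) (hp1 : p < 1) (s : ℝ) :
    -Real.log (1 - gibbsWeight p s) =
      s * -Real.log (1 - p) + Real.log (p ^ s + (1 - p) ^ s) := by
  have h1 := Real.rpow_pos_of_pos hp0 s
  have h2 := Real.rpow_pos_of_pos (sub_pos.2 hp1) s
  rw [one_sub_gibbsWeight hp0 hp1, Real.log_div h2.ne' (by positivity),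
    Real.log_rpow (sub_pos.2 hp1)]
  ring

theorem mul_freqDim_sub_betaFn (hp0 : 0 < p) (hp1 : p < 1) (A u s : ℝ) :
    s * freqDim p A u - betaFn p A s = (u * -Real.log (gibbsWeight p s) +
      (1 - u) * -Real.log (1 - gibbsWeight p s)) / Real.log A := by
  rw [neg_log_gibbsWeight hp0 hp1, neg_log_one_sub_gibbsWeight hp0 hp1, freqDim, betaFn]
  ring

theorem mul_log_sub_log_le {u g : ℝ} (hu : 0 ≤ u) (hg : 0 < g) :
    u * (Real.log g - Real.log u) ≤ g - u := by
  rcases hu.eq_or_lt with rfl | hu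
  · simpa using hg.le
  · rw [← Real.log_div hg.ne' hu.ne']
    have := mul_le_mul_of_nonneg_left (Real.log_le_sub_one_of_pos (div_pos hg hu)) hu.le
    rwa [mul_sub, mul_div_cancel₀ _ hu.ne', mul_one] at this

/-- Gibbs' inequality for two letters. -/
theorem binEntropy_le_cross {u g : ℝ} (hu0 : 0 ≤ u) (hu1 : u ≤ 1) (hg0 : 0 < g) (hg1 : g < 1) :
    Real.binEntropy u ≤ u * -Real.log g + (1 - u) * -Real.log (1 - g) := by
  have h1 := mul_log_sub_log_le hu0 hg0
  have h2 := mul_log_sub_log_le (sub_nonneg.2 hu1) (sub_pos.2 hg1)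
  rw [Real.binEntropy, Real.log_inv, Real.log_inv]
  linarith

theorem binEntropy_div_le (hp0 : 0 < p) (hp1 : p < 1) {A : ℝ} (hA : 1 < A) {u : ℝ}
    (hu0 : 0 ≤ u) (hu1 : u ≤ 1) (s : ℝ) :
    Real.binEntropy u / Real.log A ≤ s * freqDim p A u - betaFn p A s := by
  rw [mul_freqDim_sub_betaFn hp0 hp1]
  exact div_le_div_of_nonneg_right
    (binEntropy_le_cross hu0 hu1 (gibbsWeight_pos hp0 hp1 s) (gibbsWeight_lt_one hp0 hp1 s))
    (Real.log_pos hA).le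

theorem legendre_eq (hp0 : 0 < p) (hp1 : p < 1) {A : ℝ} (hA : 1 < A) {u : ℝ}
    (hu0 : 0 ≤ u) (hu1 : u ≤ 1)
    (h : ∀ ε > 0, ∃ s, s * freqDim p A u - betaFn p A s ≤ Real.binEntropy u / Real.log A + ε) :
    legendre (betaFn p A) (freqDim p A u) = Real.binEntropy u / Real.log A := by
  refine le_antisymm (le_of_forall_pos_le_add fun ε hε => ?_)
    (le_ciInf (binEntropy_div_le hp0 hp1 hA hu0 hu1))
  obtain ⟨s, hs⟩ := h ε hε
  exact (ciInf_le ⟨_, by rintro _ ⟨s, rfl⟩; exact binEntropy_div_le hp0 hp1 hA hu0 hu1 s⟩ s).trans hs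

/-- Every weight in `(0, 1)` is a Gibbs weight when `p ≠ 1 / 2`. -/
theorem exists_gibbsWeight_eq (hp0 : 0 < p) (hp2 : p < 1 / 2) {g : ℝ} (hg0 : 0 < g) (hg1 : g < 1) :
    ∃ s, gibbsWeight p s = g ∧ (g ≤ p → 1 ≤ s) ∧ (1 / 2 ≤ g → s ≤ 0) := by
  have hp1 : 0 < 1 - p := by linarith
  have hg1' : 0 < 1 - g := by linarith
  have hl : Real.log (p / (1 - p)) < 0 :=
    Real.log_neg (by positivity) ((div_lt_one hp1).2 (by linarith))
  refine ⟨Real.log (g / (1 - g)) / Real.log (p / (1 - p)), ?_, fun h => ?_, fun h => ?_⟩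
  · set s := Real.log (g / (1 - g)) / Real.log (p / (1 - p)) with hs
    have h1 : p ^ s / (1 - p) ^ s = g / (1 - g) := by
      rw [← Real.div_rpow hp0.le hp1.le, Real.rpow_def_of_pos (by positivity), hs,
        mul_div_cancel₀ _ hl.ne, Real.exp_log (by positivity)]
    have h2 := Real.rpow_pos_of_pos hp0 s
    have h3 := Real.rpow_pos_of_pos hp1 s
    rw [div_eq_div_iff h3.ne' hg1'.ne'] at h1
    rw [gibbsWeight, div_eq_iff (by positivity)]
    linarith
  · rw [le_div_iff_of_neg hl, one_mul]
    refine Real.log_le_log (by positivity) ?_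
    rw [div_le_div_iff₀ hg1' hp1]
    nlinarith
  · refine div_nonpos_of_nonneg_of_nonpos (Real.log_nonneg ?_) hl.le
    rw [le_div_iff₀ hg1']
    linarith

theorem mul_freqDim_sub_betaFn_of_eq (hp0 : 0 < p) (hp1 : p < 1) (A : ℝ) {u s : ℝ}
    (h : gibbsWeight p s = u) :
    s * freqDim p A u - betaFn p A s = Real.binEntropy u / Real.log A := by
  rw [mul_freqDim_sub_betaFn hp0 hp1, h, Real.binEntropy, Real.log_inv, Real.log_inv]

theorem exists_one_le_approx (hp0 : 0 < p) (hp2 : p < 1 / 2) {A : ℝ} (hA : 1 < A) {u : ℝ}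
    (hu0 : 0 ≤ u) (hup : u ≤ p) {ε : ℝ} (hε : 0 < ε) :
    ∃ s, 1 ≤ s ∧ s * freqDim p A u - betaFn p A s ≤ Real.binEntropy u / Real.log A + ε := by
  have hlA := Real.log_pos hA
  have hp1 : p < 1 := by linarith
  rcases hu0.eq_or_lt with rfl | hu0
  · have he : Real.exp (-(ε * Real.log A)) < 1 :=
      Real.exp_lt_one_iff.2 (neg_lt_zero.2 (by positivity))
    set g := min p (1 - Real.exp (-(ε * Real.log A))) with hg
    obtain ⟨s, hs, h1, -⟩ := exists_gibbsWeight_eq hp0 hp2 (g := g)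
      (lt_min hp0 (by linarith)) ((min_le_left _ _).trans_lt hp1)
    refine ⟨s, h1 (min_le_left _ _), ?_⟩
    rw [mul_freqDim_sub_betaFn hp0 hp1, hs, Real.binEntropy_zero, zero_div, zero_add,
      div_le_iff₀ hlA, zero_mul, zero_add, sub_zero, one_mul, neg_le,
      Real.le_log_iff_exp_le (by linarith [min_le_left p (1 - Real.exp (-(ε * Real.log A)))])]
    linarith [min_le_right p (1 - Real.exp (-(ε * Real.log A)))]
  · obtain ⟨s, hs, h1, -⟩ := exists_gibbsWeight_eq hp0 hp2 hu0 (by linarith)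
    exact ⟨s, h1 hup, by rw [mul_freqDim_sub_betaFn_of_eq hp0 hp1 A hs]; linarith⟩

theorem exists_nonpos_approx (hp0 : 0 < p) (hp2 : p < 1 / 2) {A : ℝ} (hA : 1 < A) {u : ℝ}
    (hu2 : 1 / 2 ≤ u) (hu1 : u ≤ 1) {ε : ℝ} (hε : 0 < ε) :
    ∃ s, s ≤ 0 ∧ s * freqDim p A u - betaFn p A s ≤ Real.binEntropy u / Real.log A + ε := by
  have hlA := Real.log_pos hA
  have hp1 : p < 1 := by linarith
  rcases hu1.eq_or_lt with rfl | hu1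
  · have he : Real.exp (-(ε * Real.log A)) < 1 :=
      Real.exp_lt_one_iff.2 (neg_lt_zero.2 (by positivity))
    set g := max (1 / 2) (Real.exp (-(ε * Real.log A))) with hg
    have hg0 : 0 < g := lt_max_of_lt_left (by norm_num)
    obtain ⟨s, hs, -, h1⟩ := exists_gibbsWeight_eq hp0 hp2 (g := g) hg0
      (max_lt (by norm_num) he)
    refine ⟨s, h1 (le_max_left _ _), ?_⟩
    rw [mul_freqDim_sub_betaFn hp0 hp1, hs, Real.binEntropy_one, zero_div, zero_add,
      div_le_iff₀ hlA, sub_self, zero_mul, add_zero, one_mul, neg_le,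
      Real.le_log_iff_exp_le hg0]
    exact le_max_right _ _
  · obtain ⟨s, hs, -, h1⟩ := exists_gibbsWeight_eq hp0 hp2 (show 0 < u by linarith) hu1
    exact ⟨s, h1 hu2, by rw [mul_freqDim_sub_betaFn_of_eq hp0 hp1 A hs]; linarith⟩

theorem hasDerivAt_betaFn (hp0 : 0 < p) (hp1 : p < 1) (A s : ℝ) :
    HasDerivAt (betaFn p A) (freqDim p A (gibbsWeight p s)) s := by
  have h1 := Real.rpow_pos_of_pos hp0 s
  have h2 := Real.rpow_pos_of_pos (sub_pos.2 hp1) s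
  have h3 : 0 < p ^ s + (1 - p) ^ s := add_pos h1 h2
  have hd := (((Real.hasStrictDerivAt_const_rpow hp0 s).hasDerivAt.add
    (Real.hasStrictDerivAt_const_rpow (sub_pos.2 hp1) s).hasDerivAt).log
      h3.ne').neg.div_const (Real.log A)
  refine hd.congr_deriv ?_
  rw [freqDim, one_sub_gibbsWeight hp0 hp1, gibbsWeight]
  simp only [Pi.add_apply]
  field_simp
  ring

theorem gibbsWeight_zero (p : ℝ) : gibbsWeight p 0 = 1 / 2 := by
  norm_num [gibbsWeight]

theorem gibbsWeight_one (p : ℝ) : gibbsWeight p 1 = p := by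
  simp [gibbsWeight]

theorem betaFn_zero (p A : ℝ) : betaFn p A 0 = -(Real.log 2 / Real.log A) := by
  norm_num [betaFn, neg_div]

theorem betaFn_one (p A : ℝ) : betaFn p A 1 = 0 := by
  simp [betaFn]

theorem log_rpow_add_le {q s : ℝ} (hq0 : 0 < q) (hq2 : q ≤ 1 / 2) (hs : 1 ≤ s) :
    Real.log (q ^ s + (1 - q) ^ s) ≤ (s - 1) * Real.log (1 - q) := by
  have h1 : 0 < 1 - q := by linarith
  have h2 := Real.rpow_pos_of_pos hq0 s
  have h3 := Real.rpow_pos_of_pos h1 s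
  rw [← Real.log_rpow h1]
  refine Real.log_le_log (by positivity) ?_
  have e : ∀ x : ℝ, 0 < x → x ^ s = x * x ^ (s - 1) := fun x hx => by
    rw [Real.rpow_sub_one hx.ne']
    field_simp
  rw [e q hq0, e (1 - q) h1]
  have := Real.rpow_le_rpow hq0.le (show q ≤ 1 - q by linarith) (show 0 ≤ s - 1 by linarith)
  nlinarith

theorem le_log_rpow_add (hp0 : 0 < p) (hp2 : p ≤ 1 / 2) {s : ℝ} (hs : 1 ≤ s) :
    (s - 1) * Real.log p ≤ Real.log (p ^ s + (1 - p) ^ s) := by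
  have h1 : 0 < 1 - p := by linarith
  rw [← Real.log_rpow hp0]
  refine Real.log_le_log (Real.rpow_pos_of_pos hp0 _) ?_
  have e : ∀ x : ℝ, 0 < x → x ^ s = x * x ^ (s - 1) := fun x hx => by
    rw [Real.rpow_sub_one hx.ne']
    field_simp
  rw [e p hp0, e (1 - p) h1]
  have := Real.rpow_le_rpow hp0.le (show p ≤ 1 - p by linarith) (show 0 ≤ s - 1 by linarith)
  nlinarith

theorem betaFn_le_betaFn {q A B : ℝ} (hA : 1 < A) (hB : 1 < B) (hp0 : 0 < p) (hp2 : p ≤ 1 / 2)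
    (hq0 : 0 < q) (hq2 : q ≤ 1 / 2)
    (hpq : -Real.log p / Real.log A < -Real.log (1 - q) / Real.log B) {s : ℝ} (hs : 1 ≤ s) :
    betaFn p A s ≤ betaFn q B s := by
  have hlA := Real.log_pos hA
  have hlB := Real.log_pos hB
  calc betaFn p A s ≤ -((s - 1) * Real.log p) / Real.log A :=
        div_le_div_of_nonneg_right (neg_le_neg (le_log_rpow_add hp0 hp2 hs)) hlA.le
    _ = (s - 1) * (-Real.log p / Real.log A) := by ring
    _ ≤ (s - 1) * (-Real.log (1 - q) / Real.log B) :=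
        mul_le_mul_of_nonneg_left hpq.le (by linarith)
    _ = -((s - 1) * Real.log (1 - q)) / Real.log B := by ring
    _ ≤ betaFn q B s :=
        div_le_div_of_nonneg_right (neg_le_neg (log_rpow_add_le hq0 hq2 hs)) hlB.le

end Weights

section Alternating

/-- A Moran measure whose ratios and weights are `(A, p)` on the even blocks and `(B, q)` on the
odd blocks determined by a rapidly growing sequence `N`. -/
structure IsAlternatingMoran (A B p q : ℝ) (N : ℕ → ℕ) (c R : ℕ → ℝ) (μ : Measure ℝ) : Prop where
  lt : B < A
  two_lt : 2 < B
  p_pos : 0 < p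
  p_le : p ≤ 1 / 2
  q_pos : 0 < q
  q_le : q ≤ 1 / 2
  zero : N 0 = 0
  mono : StrictMono N
  lim : Tendsto (fun i : ℕ => (N (i + 1) : ℝ) / (N i : ℝ)) atTop atTop
  dim_lt : -Real.log p / Real.log A < -Real.log (1 - q) / Real.log B
  ratio_even : ∀ k, evenBlock N k → c (k + 1) = A
  ratio_odd : ∀ k, ¬ evenBlock N k → c (k + 1) = B
  weight_even : ∀ k, evenBlock N k → R k = p
  weight_odd : ∀ k, ¬ evenBlock N k → R k = q
  mass : ∀ ω n, μ (mint c ω n) = ENNReal.ofReal (bmass R ω n)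

theorem neg_log_one_sub_le_freqDim {p A : ℝ} (hp0 : 0 < p) (hp2 : p ≤ 1 / 2) (hA : 1 < A) {u : ℝ}
    (hu : 0 ≤ u) : -Real.log (1 - p) / Real.log A ≤ freqDim p A u := by
  refine div_le_div_of_nonneg_right ?_ (Real.log_pos hA).le
  have := Real.log_le_log hp0 (show p ≤ 1 - p by linarith)
  nlinarith

theorem freqDim_le_neg_log {p A : ℝ} (hp0 : 0 < p) (hp2 : p ≤ 1 / 2) (hA : 1 < A) {u : ℝ}
    (hu : u ≤ 1) : freqDim p A u ≤ -Real.log p / Real.log A := by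
  refine div_le_div_of_nonneg_right ?_ (Real.log_pos hA).le
  have := Real.log_le_log hp0 (show p ≤ 1 - p by linarith)
  nlinarith

theorem freqDim_self (p A : ℝ) : freqDim p A p = Real.binEntropy p / Real.log A := by
  rw [freqDim, Real.binEntropy, Real.log_inv, Real.log_inv]

theorem freqDim_mul_log {A : ℝ} (hA : 1 < A) (p u : ℝ) :
    freqDim p A u * Real.log A = u * -Real.log p + (1 - u) * -Real.log (1 - p) :=
  div_mul_cancel₀ _ (Real.log_pos hA).ne'

theorem bmean_neg_log (v R : ℕ → ℝ) (k : ℕ) :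
    bmean v k (fun b => -Real.log (bwt R k b)) =
      v k * -Real.log (R k) + (1 - v k) * -Real.log (1 - R k) := by
  simp [bmean, bwt]

theorem bmean_neg_log_self (v : ℕ → ℝ) (k : ℕ) :
    bmean v k (fun b => -Real.log (bwt v k b)) = Real.binEntropy (v k) := by
  rw [bmean_neg_log, Real.binEntropy, Real.log_inv, Real.log_inv]

theorem logMass_gibbsWeight {R : ℕ → ℝ} (hR0 : ∀ k, 0 < R k) (hR1 : ∀ k, R k < 1) (s b : ℝ)
    (c : ℕ → ℝ) (ω : ℕ → Bool) (n : ℕ) :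
    logMass (fun k => gibbsWeight (R k) s) ω n = s * logMass R ω n - b * logLen c n +
      ∑ k ∈ Finset.range n, (Real.log (R k ^ s + (1 - R k) ^ s) + b * Real.log (c (k + 1))) := by
  rw [logMass, logMass, logLen, Finset.mul_sum, Finset.mul_sum, ← Finset.sum_sub_distrib,
    ← Finset.sum_add_distrib]
  refine Finset.sum_congr rfl fun k _ => ?_
  cases h : ω k
  · simp only [bwt, Bool.false_eq_true, if_false]
    rw [neg_log_gibbsWeight (hR0 k) (hR1 k)]
    ring
  · simp only [bwt, if_true]
    rw [neg_log_one_sub_gibbsWeight (hR0 k) (hR1 k)]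
    ring

namespace IsAlternatingMoran

variable {A B p q : ℝ} {N : ℕ → ℕ} {c R : ℕ → ℝ} {μ : Measure ℝ}

section Basic

variable (h : IsAlternatingMoran A B p q N c R μ)
include h

theorem one_lt_B : 1 < B := by linarith [h.two_lt]

theorem one_lt_A : 1 < A := by linarith [h.two_lt, h.lt]

theorem log_lt_log : Real.log B < Real.log A := Real.log_lt_log (by linarith [h.two_lt]) h.lt

theorem le_ratio (k : ℕ) : B ≤ c (k + 1) := by
  by_cases hk : evenBlock N k
  · rw [h.ratio_even k hk]; exact h.lt.le
  · rw [h.ratio_odd k hk]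

theorem min_pos : 0 < min p q := lt_min h.p_pos h.q_pos

theorem min_le_weight (k : ℕ) : min p q ≤ R k := by
  by_cases hk : evenBlock N k
  · rw [h.weight_even k hk]; exact min_le_left _ _
  · rw [h.weight_odd k hk]; exact min_le_right _ _

theorem weight_le (k : ℕ) : R k ≤ 1 - min p q := by
  have h1 := min_le_left p q
  have h2 := h.p_le
  have h3 := h.q_le
  by_cases hk : evenBlock N k
  · rw [h.weight_even k hk]; linarith
  · rw [h.weight_odd k hk]; linarith

theorem weight_pos (k : ℕ) : 0 < R k := h.min_pos.trans_le (h.min_le_weight k)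

theorem weight_lt_one (k : ℕ) : R k < 1 := by linarith [h.min_pos, h.weight_le k]

theorem freqDim_lt {u w : ℝ} (hu : u ≤ 1) (hw : 0 ≤ w) : freqDim p A u < freqDim q B w :=
  (freqDim_le_neg_log h.p_pos h.p_le h.one_lt_A hu).trans_lt
    (h.dim_lt.trans_le (neg_log_one_sub_le_freqDim h.q_pos h.q_le h.one_lt_B hw))

theorem freqDim_pos {u : ℝ} (hu : 0 ≤ u) : 0 < freqDim p A u := by
  refine lt_of_lt_of_le ?_ (neg_log_one_sub_le_freqDim h.p_pos h.p_le h.one_lt_A hu)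
  exact div_pos (neg_pos.2 (Real.log_neg (by linarith [h.p_le]) (by linarith [h.p_pos])))
    (Real.log_pos h.one_lt_A)

theorem le_mul_logLen (ε : ℝ) (hε : 0 < ε) (n : ℕ) : ε * Real.log B * n ≤ ε * logLen c n := by
  have := mul_le_mul_of_nonneg_left (mul_le_logLen h.two_lt h.le_ratio n) hε.le
  linarith

end Basic

variable [IsProbabilityMeasure μ] (h : IsAlternatingMoran A B p q N c R μ)
include h

theorem dimH_le_of_one_le {α s : ℝ} (hα : 0 < α) (hs : 1 ≤ s)
    (hd : 0 ≤ s * α - betaFn p A s) :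
    dimH {x | x ∈ moranSet c ∧ lowerLocalDim μ x = α} ≤
      ENNReal.ofReal (s * α - betaFn p A s) := by
  refine dimH_lowerLocalDim_eq_le (v := fun k => gibbsWeight (R k) s) h.two_lt h.le_ratio h.min_pos
    h.min_le_weight h.weight_le h.mass (fun k => gibbsWeight_pos (h.weight_pos k) (h.weight_lt_one k) s)
    (fun k => gibbsWeight_lt_one (h.weight_pos k) (h.weight_lt_one k) s) hα hd ?_
  intro ω _ hf ε hε
  have hs0 : 0 < s := by linarith
  refine (hf (ε / s) (by positivity)).mono fun n hn => ?_
  rw [logMass_gibbsWeight h.weight_pos h.weight_lt_one s (betaFn p A s) c]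
  have hneg : ∑ k ∈ Finset.range n, (Real.log (R k ^ s + (1 - R k) ^ s) +
      betaFn p A s * Real.log (c (k + 1))) ≤ 0 := by
    refine Finset.sum_nonpos fun k _ => ?_
    by_cases hk : evenBlock N k
    · rw [h.weight_even k hk, h.ratio_even k hk, ← neg_betaFn p h.one_lt_A]
      linarith
    · rw [h.weight_odd k hk, h.ratio_odd k hk, ← neg_betaFn q h.one_lt_B]
      have := mul_le_mul_of_nonneg_right (betaFn_le_betaFn h.one_lt_A h.one_lt_B h.p_pos h.p_le
        h.q_pos h.q_le h.dim_lt hs) (Real.log_pos h.one_lt_B).le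
      linarith
  have h1 := mul_le_mul_of_nonneg_left hn hs0.le
  have h2 : s * ((α + ε / s) * logLen c n) = (s * α + ε) * logLen c n := by
    field_simp
  linarith

theorem dimH_le_of_nonpos {α s : ℝ} (hα : 0 < α) (hs : s ≤ 0)
    (hd : 0 ≤ s * α - betaFn p A s) :
    dimH {x | x ∈ moranSet c ∧ lowerLocalDim μ x = α} ≤
      ENNReal.ofReal (s * α - betaFn p A s) := by
  refine dimH_lowerLocalDim_eq_le (v := fun k => gibbsWeight (R k) s) h.two_lt h.le_ratio h.min_pos
    h.min_le_weight h.weight_le h.mass (fun k => gibbsWeight_pos (h.weight_pos k) (h.weight_lt_one k) s)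
    (fun k => gibbsWeight_lt_one (h.weight_pos k) (h.weight_lt_one k) s) hα hd ?_
  intro ω he _ ε hε
  have hlB := Real.log_pos h.one_lt_B
  have hs1 : 0 < 1 - s := by linarith
  have hx : ∀ k, evenBlock N k → Real.log (R k ^ s + (1 - R k) ^ s) +
      betaFn p A s * Real.log (c (k + 1)) = 0 := fun k hk => by
    rw [h.weight_even k hk, h.ratio_even k hk, ← neg_betaFn p h.one_lt_A]
    ring
  have hK : ∀ k, |Real.log (R k ^ s + (1 - R k) ^ s) + betaFn p A s * Real.log (c (k + 1))| ≤
      |Real.log (q ^ s + (1 - q) ^ s) + betaFn p A s * Real.log B| := fun k => by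
    by_cases hk : evenBlock N k
    · rw [hx k hk, abs_zero]; exact abs_nonneg _
    · rw [h.weight_odd k hk, h.ratio_odd k hk]
  refine ((frequently_abs_sum_le h.mono h.lim hK hx (ε := ε / 2 * Real.log B)
    (by positivity)).and_eventually (he (ε / 2 / (1 - s)) (by positivity))).mono fun n ⟨a, b⟩ => ?_
  rw [logMass_gibbsWeight h.weight_pos h.weight_lt_one s (betaFn p A s) c]
  have h1 := mul_le_mul_of_nonpos_left b hs
  have h2 := (le_abs_self _).trans a
  have h3 := h.le_mul_logLen (ε / 2) (by positivity) n
  have hL : 0 ≤ logLen c n :=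
    (mul_nonneg (Nat.cast_nonneg n) hlB.le).trans (mul_le_logLen h.two_lt h.le_ratio n)
  have h4 : -s * (ε / 2 / (1 - s)) ≤ ε / 2 := by
    rw [← mul_div_assoc, div_le_iff₀ hs1]
    nlinarith
  have h5 := mul_le_mul_of_nonneg_right h4 hL
  linarith

theorem le_dimH_of_freq {u : ℝ} (hu0 : 0 < u) (hu1 : u < 1) :
    ENNReal.ofReal (Real.binEntropy u / Real.log A) ≤
      dimH {x | x ∈ moranSet c ∧ lowerLocalDim μ x = freqDim p A u} := by
  classical
  have hlA := Real.log_pos h.one_lt_A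
  have hlB := Real.log_pos h.one_lt_B
  let v : ℕ → ℝ := fun k => if evenBlock N k then u else 1 / 2
  have hve : ∀ k, evenBlock N k → v k = u := fun k hk => if_pos hk
  have hvo : ∀ k, ¬ evenBlock N k → v k = 1 / 2 := fun k hk => if_neg hk
  have hL : ∀ n, 0 ≤ logLen c n := fun n =>
    (mul_nonneg (Nat.cast_nonneg n) hlB.le).trans (mul_le_logLen h.two_lt h.le_ratio n)
  have he : ∀ k, evenBlock N k → bmean v k (fun b => -Real.log (bwt R k b)) =
      freqDim p A u * Real.log (c (k + 1)) := fun k hk => by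
    rw [bmean_neg_log, hve k hk, h.weight_even k hk, h.ratio_even k hk, freqDim_mul_log h.one_lt_A]
  have ho : ∀ k, ¬ evenBlock N k → bmean v k (fun b => -Real.log (bwt R k b)) =
      freqDim q B (1 / 2) * Real.log (c (k + 1)) := fun k hk => by
    rw [bmean_neg_log, hvo k hk, h.weight_odd k hk, h.ratio_odd k hk, freqDim_mul_log h.one_lt_B]
  have hx : ∀ k, evenBlock N k → bmean v k (fun b => -Real.log (bwt R k b)) -
      freqDim p A u * Real.log (c (k + 1)) = 0 := fun k hk => by rw [he k hk, sub_self]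
  have hK : ∀ k, |bmean v k (fun b => -Real.log (bwt R k b)) -
      freqDim p A u * Real.log (c (k + 1))| ≤
      |freqDim q B (1 / 2) * Real.log B - freqDim p A u * Real.log B| := fun k => by
    by_cases hk : evenBlock N k
    · rw [hx k hk, abs_zero]; exact abs_nonneg _
    · rw [ho k hk, h.ratio_odd k hk]
  refine le_dimH_lowerLocalDim_eq (v := v) (v₀ := min u (1 - u)) h.two_lt h.le_ratio h.min_pos
    h.min_le_weight h.weight_le h.mass (lt_min hu0 (by linarith)) (fun k => ?_) (fun k => ?_)
    (h.freqDim_pos hu0.le) (fun ε hε => Eventually.of_forall fun n => ?_) (fun ε hε => ?_)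
    (fun ε hε => Eventually.of_forall fun n => ?_)
  · have h1 := min_le_left u (1 - u)
    have h2 := min_le_right u (1 - u)
    by_cases hk : evenBlock N k
    · rwa [hve k hk]
    · rw [hvo k hk]; linarith
  · have h1 := min_le_left u (1 - u)
    have h2 := min_le_right u (1 - u)
    by_cases hk : evenBlock N k
    · rw [hve k hk]; linarith
    · rw [hvo k hk]; linarith
  · have h1 : freqDim p A u * logLen c n ≤
        ∑ k ∈ Finset.range n, bmean v k (fun b => -Real.log (bwt R k b)) := by
      rw [logLen, Finset.mul_sum]
      refine Finset.sum_le_sum fun k _ => ?_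
      by_cases hk : evenBlock N k
      · rw [he k hk]
      · rw [ho k hk, h.ratio_odd k hk]
        exact mul_le_mul_of_nonneg_right (h.freqDim_lt hu1.le (by norm_num)).le hlB.le
    nlinarith [hL n]
  · refine (frequently_abs_sum_le h.mono h.lim hK hx (ε := ε * Real.log B)
      (by positivity)).mono fun n hn => ?_
    have h1 := (le_abs_self _).trans hn
    have h2 := h.le_mul_logLen ε hε n
    rw [Finset.sum_sub_distrib, ← Finset.mul_sum, ← logLen] at h1
    linarith
  · have h1 : Real.binEntropy u / Real.log A * logLen c n ≤
        ∑ k ∈ Finset.range n, bmean v k (fun b => -Real.log (bwt v k b)) := by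
      rw [logLen, Finset.mul_sum]
      refine Finset.sum_le_sum fun k _ => ?_
      rw [bmean_neg_log_self]
      by_cases hk : evenBlock N k
      · rw [hve k hk, h.ratio_even k hk, div_mul_cancel₀ _ hlA.ne']
      · rw [hvo k hk, h.ratio_odd k hk, one_div, Real.binEntropy_two_inv, div_mul_eq_mul_div,
          div_le_iff₀ hlA]
        exact mul_le_mul Real.binEntropy_le_log_two h.log_lt_log.le hlB.le
          (Real.log_nonneg (by norm_num))
    nlinarith [hL n]

theorem le_dimH_of_between {α : ℝ} (hα1 : freqDim p A p < α) (hα2 : α < freqDim p A (1 / 2)) :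
    ENNReal.ofReal (min α (Real.log 2 / Real.log A)) ≤
      dimH {x | x ∈ moranSet c ∧ lowerLocalDim μ x = α} := by
  classical
  have hlA := Real.log_pos h.one_lt_A
  have hlB := Real.log_pos h.one_lt_B
  set d := min α (Real.log 2 / Real.log A) with hd
  have hdα : d ≤ α := min_le_left _ _
  have hd2 : d * Real.log A ≤ Real.log 2 := (le_div_iff₀ hlA).1 (min_le_right _ _)
  set β := (freqDim q B q - α) * Real.log B with hβ
  set γ := (α - freqDim p A p) * Real.log A with hγ
  have hβ0 : 0 < β := mul_pos (sub_pos.2 (hα2.trans (h.freqDim_lt (by norm_num) h.q_pos.le))) hlB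
  have hγ0 : 0 < γ := mul_pos (sub_pos.2 hα1) hlA
  set t := β / γ with ht
  have htβ : γ * t = β := mul_div_cancel₀ _ hγ0.ne'
  let v : ℕ → ℝ := fun k => if evenBlock N k then (if earlyBlock N t k then p else 1 / 2) else q
  have hvo : ∀ k, ¬ evenBlock N k → v k = q := fun k hk => if_neg hk
  have hvE : ∀ k, earlyBlock N t k → v k = p := fun k hk =>
    (if_pos (evenBlock_of_earlyBlock hk)).trans (if_pos hk)
  have hvL : ∀ k, evenBlock N k → ¬ earlyBlock N t k → v k = 1 / 2 := fun k hk hk' =>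
    (if_pos hk).trans (if_neg hk')
  have hL : ∀ n, 0 ≤ logLen c n := fun n =>
    (mul_nonneg (Nat.cast_nonneg n) hlB.le).trans (mul_le_logLen h.two_lt h.le_ratio n)
  let e : ℕ → ℝ := fun k =>
    bmean v k (fun b => -Real.log (bwt R k b)) - α * Real.log (c (k + 1))
  have heo : ∀ k, ¬ evenBlock N k → e k = β := fun k hk => by
    simp only [e]
    rw [bmean_neg_log, hvo k hk, h.weight_odd k hk, h.ratio_odd k hk, ← freqDim_mul_log h.one_lt_B]
    ring
  have heE : ∀ k, earlyBlock N t k → e k = -γ := fun k hk => by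
    have hk' := evenBlock_of_earlyBlock hk
    simp only [e]
    rw [bmean_neg_log, hvE k hk, h.weight_even k hk', h.ratio_even k hk',
      ← freqDim_mul_log h.one_lt_A]
    ring
  have heL : ∀ k, evenBlock N k → ¬ earlyBlock N t k →
      e k = (freqDim p A (1 / 2) - α) * Real.log A := fun k hk hk' => by
    simp only [e]
    rw [bmean_neg_log, hvL k hk hk', h.weight_even k hk, h.ratio_even k hk,
      ← freqDim_mul_log h.one_lt_A]
    ring
  have hκ : 0 < (freqDim p A (1 / 2) - α) * Real.log A := mul_pos (sub_pos.2 hα2) hlA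
  let e' : ℕ → ℝ := fun k =>
    bmean v k (fun b => -Real.log (bwt v k b)) - d * Real.log (c (k + 1))
  have heo' : ∀ k, ¬ evenBlock N k → β ≤ e' k := fun k hk => by
    simp only [e']
    rw [bmean_neg_log_self, hvo k hk, h.ratio_odd k hk, hβ, freqDim_self]
    have := mul_le_mul_of_nonneg_right hdα hlB.le
    rw [sub_mul, div_mul_cancel₀ _ hlB.ne']
    linarith
  have heE' : ∀ k, earlyBlock N t k → -γ ≤ e' k := fun k hk => by
    have hk' := evenBlock_of_earlyBlock hk
    simp only [e']
    rw [bmean_neg_log_self, hvE k hk, h.ratio_even k hk', hγ, freqDim_self]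
    have := mul_le_mul_of_nonneg_right hdα hlA.le
    rw [sub_mul, div_mul_cancel₀ _ hlA.ne']
    linarith
  have heL' : ∀ k, evenBlock N k → ¬ earlyBlock N t k → 0 ≤ e' k := fun k hk hk' => by
    simp only [e']
    rw [bmean_neg_log_self, hvL k hk hk', h.ratio_even k hk, one_div, Real.binEntropy_two_inv]
    linarith
  have hK : ∀ k, e k ≤ max β ((freqDim p A (1 / 2) - α) * Real.log A) := fun k => by
    by_cases hk : evenBlock N k
    · by_cases hk' : earlyBlock N t k
      · rw [heE k hk']
        exact le_max_of_le_left (by linarith)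
      · rw [heL k hk hk']
        exact le_max_right _ _
    · rw [heo k hk]
      exact le_max_left _ _
  have hcases : ∀ k, v k = p ∨ v k = 1 / 2 ∨ v k = q := fun k => by
    by_cases hk : evenBlock N k
    · by_cases hk' : earlyBlock N t k
      · exact Or.inl (hvE k hk')
      · exact Or.inr (Or.inl (hvL k hk hk'))
    · exact Or.inr (Or.inr (hvo k hk))
  have hm1 := min_le_left p q
  have hm2 := min_le_right p q
  have hp2 := h.p_le
  have hq2 := h.q_le
  refine le_dimH_lowerLocalDim_eq (v := v) h.two_lt h.le_ratio h.min_pos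
    h.min_le_weight h.weight_le h.mass h.min_pos (fun k => ?_) (fun k => ?_)
    ((h.freqDim_pos h.p_pos.le).trans hα1) (fun ε hε => ?_) (fun ε hε => ?_) (fun ε hε => ?_)
  · rcases hcases k with hk | hk | hk <;> rw [hk] <;> linarith
  · rcases hcases k with hk | hk | hk <;> rw [hk] <;> linarith
  · filter_upwards [eventually_le_sum_earlyBlock h.zero h.mono h.lim hβ0 hγ0 htβ
      (fun k hk => (heo k hk).ge) (fun k hk => (heE k hk).ge)
      (fun k hk hk' => (heL k hk hk').symm ▸ hκ.le) (ε := ε * Real.log B) (by positivity)] with n hn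
    have h2 := h.le_mul_logLen ε hε n
    simp only [e] at hn
    rw [Finset.sum_sub_distrib, ← Finset.mul_sum, ← logLen] at hn
    linarith
  · refine (frequently_sum_earlyBlock_le h.mono h.lim hβ0 hγ0 htβ hK
      (fun k hk => (heo k hk).le) (fun k hk => (heE k hk).le) (ε := ε * Real.log B)
      (by positivity)).mono fun n hn => ?_
    have h2 := h.le_mul_logLen ε hε n
    simp only [e] at hn
    rw [Finset.sum_sub_distrib, ← Finset.mul_sum, ← logLen] at hn
    linarith
  · filter_upwards [eventually_le_sum_earlyBlock h.zero h.mono h.lim hβ0 hγ0 htβ heo' heE' heL'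
      (ε := ε * Real.log B) (by positivity)] with n hn
    have h2 := h.le_mul_logLen ε hε n
    simp only [e'] at hn
    rw [Finset.sum_sub_distrib, ← Finset.mul_sum, ← logLen] at hn
    linarith

end IsAlternatingMoran

end Alternating

section Spectrum

theorem freqDim_zero (p A : ℝ) : freqDim p A 0 = -Real.log (1 - p) / Real.log A := by
  simp [freqDim]

theorem freqDim_one (p A : ℝ) : freqDim p A 1 = -Real.log p / Real.log A := by
  simp [freqDim]

theorem freqDim_half (A u : ℝ) : freqDim (1 / 2) A u = Real.log 2 / Real.log A := by
  rw [freqDim, one_div, Real.log_inv, show (1 : ℝ) - 2⁻¹ = 2⁻¹ by norm_num, Real.log_inv]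
  ring

theorem freqDim_strictMono {p A : ℝ} (hp0 : 0 < p) (hp2 : p < 1 / 2) (hA : 1 < A) :
    StrictMono (freqDim p A) := fun u w huw => by
  have hl := Real.log_lt_log hp0 (show p < 1 - p by linarith)
  refine div_lt_div_of_pos_right ?_ (Real.log_pos hA)
  nlinarith

theorem freqDim_surjective {p A : ℝ} (hp0 : 0 < p) (hp2 : p < 1 / 2) (hA : 1 < A) :
    Function.Surjective (freqDim p A) := fun α => by
  have hl := sub_pos.2 (Real.log_lt_log hp0 (show p < 1 - p by linarith))
  have hlA := Real.log_pos hA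
  refine ⟨(α * Real.log A + Real.log (1 - p)) / (Real.log (1 - p) - Real.log p), ?_⟩
  rw [freqDim, div_eq_iff hlA.ne']
  have := div_mul_cancel₀ (α * Real.log A + Real.log (1 - p)) hl.ne'
  linarith


namespace IsAlternatingMoran

variable {A B p q : ℝ} {N : ℕ → ℕ} {c R : ℕ → ℝ} {μ : Measure ℝ} [IsProbabilityMeasure μ]
  (h : IsAlternatingMoran A B p q N c R μ)
include h

theorem le_dimH {u : ℝ} (hu0 : 0 ≤ u) (hu1 : u ≤ 1) :
    ENNReal.ofReal (Real.binEntropy u / Real.log A) ≤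
      dimH {x | x ∈ moranSet c ∧ lowerLocalDim μ x = freqDim p A u} := by
  rcases hu0.eq_or_lt with rfl | hu0
  · simp
  rcases hu1.eq_or_lt with rfl | hu1
  · simp
  exact h.le_dimH_of_freq hu0 hu1

theorem dimH_eq_legendre {u : ℝ} (hu0 : 0 ≤ u) (hu1 : u ≤ 1)
    (hs : ∀ ε > 0, ∃ s, (1 ≤ s ∨ s ≤ 0) ∧
      s * freqDim p A u - betaFn p A s ≤ Real.binEntropy u / Real.log A + ε) :
    dimH {x | x ∈ moranSet c ∧ lowerLocalDim μ x = freqDim p A u} =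
      ENNReal.ofReal (legendre (betaFn p A) (freqDim p A u)) := by
  have hp1 : p < 1 := by linarith [h.p_le]
  have hA := h.one_lt_A
  have hent : 0 ≤ Real.binEntropy u / Real.log A :=
    div_nonneg (Real.binEntropy_nonneg hu0 hu1) (Real.log_pos hA).le
  rw [legendre_eq h.p_pos hp1 hA hu0 hu1 fun ε hε => (hs ε hε).imp fun _ hs => hs.2]
  refine le_antisymm (ENNReal.le_of_forall_pos_le_add fun ε hε _ => ?_) (h.le_dimH hu0 hu1)
  obtain ⟨s, hs, hle⟩ := hs ε hε
  have h0 := hent.trans (binEntropy_div_le h.p_pos hp1 hA hu0 hu1 s)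
  have hup : dimH {x | x ∈ moranSet c ∧ lowerLocalDim μ x = freqDim p A u} ≤
      ENNReal.ofReal (s * freqDim p A u - betaFn p A s) := by
    rcases hs with hs | hs
    · exact h.dimH_le_of_one_le (h.freqDim_pos hu0) hs h0
    · exact h.dimH_le_of_nonpos (h.freqDim_pos hu0) hs h0
  refine hup.trans ((ENNReal.ofReal_le_ofReal hle).trans ?_)
  rw [ENNReal.ofReal_add hent ε.coe_nonneg, ENNReal.ofReal_coe_nnreal]

theorem dimH_eq_legendre_of_mem {α : ℝ}
    (hα : (-Real.log (1 - p) / Real.log A ≤ α ∧ α < freqDim p A p) ∨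
      (freqDim p A (1 / 2) ≤ α ∧ α ≤ -Real.log p / Real.log A)) :
    dimH {x | x ∈ moranSet c ∧ lowerLocalDim μ x = α} =
      ENNReal.ofReal (legendre (betaFn p A) α) := by
  have hA := h.one_lt_A
  rw [← freqDim_zero, ← freqDim_one] at hα
  rcases h.p_le.eq_or_lt with rfl | hp2
  · simp only [freqDim_half] at hα
    obtain rfl : α = freqDim (1 / 2) A (1 / 2) := by
      rw [freqDim_half]
      rcases hα with ⟨h1, h2⟩ | ⟨h1, h2⟩ <;> linarith
    refine h.dimH_eq_legendre (by norm_num) (by norm_num) fun ε hε => ⟨0, Or.inr le_rfl, ?_⟩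
    rw [mul_freqDim_sub_betaFn_of_eq (by norm_num) (by norm_num) A (gibbsWeight_zero _)]
    linarith
  · have hmono := freqDim_strictMono h.p_pos hp2 hA
    obtain ⟨u, rfl⟩ := freqDim_surjective h.p_pos hp2 hA α
    simp only [hmono.le_iff_le, hmono.lt_iff_lt] at hα
    rcases hα with ⟨h1, h2⟩ | ⟨h1, h2⟩
    · refine h.dimH_eq_legendre h1 (by linarith) fun ε hε => ?_
      obtain ⟨s, hs, hle⟩ := exists_one_le_approx h.p_pos hp2 hA h1 h2.le hε
      exact ⟨s, Or.inl hs, hle⟩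
    · refine h.dimH_eq_legendre (by linarith) h2 fun ε hε => ?_
      obtain ⟨s, hs, hle⟩ := exists_nonpos_approx h.p_pos hp2 hA h1 h2 hε
      exact ⟨s, Or.inr hs, hle⟩

theorem dimH_eq_min {α : ℝ} (h1 : freqDim p A p ≤ α) (h2 : α < freqDim p A (1 / 2)) :
    dimH {x | x ∈ moranSet c ∧ lowerLocalDim μ x = α} =
      ENNReal.ofReal (min α (Real.log 2 / Real.log A)) := by
  have hlA := Real.log_pos h.one_lt_A
  have hα : 0 < α := (h.freqDim_pos h.p_pos.le).trans_le h1
  have h2A : 0 ≤ Real.log 2 / Real.log A := div_nonneg (Real.log_nonneg (by norm_num)) hlA.le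
  refine le_antisymm ?_ ?_
  · rw [ENNReal.ofReal_min]
    refine le_min ?_ ?_
    · have := h.dimH_le_of_one_le hα le_rfl (by rw [betaFn_one]; linarith)
      rwa [betaFn_one, one_mul, sub_zero] at this
    · have := h.dimH_le_of_nonpos hα le_rfl (by rw [betaFn_zero]; linarith)
      rwa [betaFn_zero, zero_mul, zero_sub, neg_neg] at this
  · rcases h1.eq_or_lt with rfl | h1
    · refine le_trans (ENNReal.ofReal_le_ofReal ?_)
        (h.le_dimH h.p_pos.le (by linarith [h.p_le]))
      rw [freqDim_self]
      exact min_le_left _ _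
    · exact h.le_dimH_of_between h1 h2

end IsAlternatingMoran

end Spectrum

/-- the explicit piecewise formula for dim_H E̲(μ,α):
it equals β₁^*(α) for α ∈ [β₁'(+∞), β₁'(1)) ∪ [β₁'(0), β₁'(−∞)]
(where β₁'(+∞) = −log(1−p)/log A and β₁'(−∞) = −log p/log A),
and equals min{α, log 2/log A} for α ∈ [β₁'(1), β₁'(0)). -/
theorem stmt_9 (A B p q : ℝ) (N : ℕ → ℕ)
    (hBA : B < A) (hB2 : 2 < B)
    (hp0 : 0 < p) (hp2 : p ≤ 1 / 2) (hq0 : 0 < q) (hq2 : q ≤ 1 / 2)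
    (hN0 : N 0 = 0) (hNmono : StrictMono N)
    (hNlim : Tendsto (fun i : ℕ => (N (i + 1) : ℝ) / (N i : ℝ)) atTop atTop)
    (hpq : -Real.log p / Real.log A < -Real.log (1 - q) / Real.log B)
    (c r : ℕ → ℝ)
    (hcA : ∀ i n : ℕ, N (2 * i) < n → n ≤ N (2 * i + 1) → c n = A)
    (hcB : ∀ i n : ℕ, N (2 * i + 1) < n → n ≤ N (2 * i + 2) → c n = B)
    (hrp : ∀ i n : ℕ, N (2 * i) < n → n ≤ N (2 * i + 1) → r n = p)
    (hrq : ∀ i n : ℕ, N (2 * i + 1) < n → n ≤ N (2 * i + 2) → r n = q)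
    (μ : Measure ℝ) [IsProbabilityMeasure μ]
    (hμ : ∀ w : List Bool, μ (moranI c w) = ENNReal.ofReal (cylMass r w 1 1))
    :
    (∀ α : ℝ,
        ((-Real.log (1 - p) / Real.log A ≤ α ∧ α < deriv (betaFn p A) 1) ∨
          (deriv (betaFn p A) 0 ≤ α ∧ α ≤ -Real.log p / Real.log A)) →
        dimH {x | x ∈ moranSet c ∧ lowerLocalDim μ x = α} =
          ENNReal.ofReal (legendre (betaFn p A) α)) ∧
    (∀ α : ℝ, deriv (betaFn p A) 1 ≤ α → α < deriv (betaFn p A) 0 →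
        dimH {x | x ∈ moranSet c ∧ lowerLocalDim μ x = α} =
          ENNReal.ofReal (min α (Real.log 2 / Real.log A))) := by
  have hA : 1 < A := by linarith
  have hp1 : p < 1 := by linarith
  have hodd : ∀ k, ¬ evenBlock N k → ∃ i, N (2 * i + 1) < k + 1 ∧ k + 1 ≤ N (2 * i + 2) :=
    fun k hk => (exists_oddBlock hN0 hNmono hk).imp fun i hi => ⟨by omega, by omega⟩
  have h : IsAlternatingMoran A B p q N c (fun k => r (k + 1)) μ :=
    { lt := hBA
      two_lt := hB2
      p_pos := hp0
      p_le := hp2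
      q_pos := hq0
      q_le := hq2
      zero := hN0
      mono := hNmono
      lim := hNlim
      dim_lt := hpq
      ratio_even := fun k ⟨i, h1, h2⟩ => hcA i (k + 1) (by omega) h2
      ratio_odd := fun k hk => by
        obtain ⟨i, h1, h2⟩ := hodd k hk
        exact hcB i (k + 1) h1 h2
      weight_even := fun k ⟨i, h1, h2⟩ => hrp i (k + 1) (by omega) h2
      weight_odd := fun k hk => by
        obtain ⟨i, h1, h2⟩ := hodd k hk
        exact hrq i (k + 1) h1 h2
      mass := fun ω n => by rw [← moranI_pref, hμ, cylMass_pref] }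
  rw [(hasDerivAt_betaFn hp0 hp1 A 1).deriv, (hasDerivAt_betaFn hp0 hp1 A 0).deriv,
    gibbsWeight_one, gibbsWeight_zero]
  exact ⟨fun α hα => h.dimH_eq_legendre_of_mem hα, fun α h1 h2 => h.dimH_eq_min h1 h2⟩
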